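/- arXiv:1308.6559 — 2 statements merged into one kernel-verified Lean document; each statement's English description precedes it below -/
import Mathlib

section
/- Let (φ1, φ2) be an admissible even pair, let 0 < m1 ≤ m2 be reals, let α ∈ [0,1], and set n = α·m1 + (1−α)·m2 and φ = α·φ1 + (1−α)·φ2. Then for every x ∈ ℝ and every t ∈ [0,1], F_{φ,n}(x,t) ≤ α·F_{φ1,m1}(x,t) + (1−α)·F_{φ2,m2}(x,t). -/
open MeasureTheory ProbabilityTheory Set

/-- `parisiF φ m x t = (1/m) log E[exp (m φ(x + √t Z))]` with `Z` standard Gaussian. -/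
noncomputable def parisiF (φ : ℝ → ℝ) (m : ℝ) (x t : ℝ) : ℝ :=
  (1 / m) * Real.log (∫ z, Real.exp (m * φ (x + Real.sqrt t * z)) ∂(gaussianReal 0 1))

/-- `φ` is twice differentiable with bounded first and second derivatives. -/
def TwiceDiffBounded (φ : ℝ → ℝ) : Prop :=
  Differentiable ℝ φ ∧ Differentiable ℝ (deriv φ) ∧
    (∃ C, ∀ x, |deriv φ x| ≤ C) ∧ (∃ C, ∀ x, |deriv (deriv φ) x| ≤ C)

/-- An admissible even pair. -/
def AdmissibleEvenPair (φ1 φ2 : ℝ → ℝ) : Prop :=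
  TwiceDiffBounded φ1 ∧ TwiceDiffBounded φ2 ∧
    (∀ x, φ1 (-x) = φ1 x) ∧ (∀ x, φ2 (-x) = φ2 x) ∧
    ConvexOn ℝ Set.univ φ1 ∧ ConvexOn ℝ Set.univ φ2 ∧
    (∀ x, φ1 x ≤ φ2 x) ∧ (∀ x, 0 ≤ x → deriv φ1 x ≤ deriv φ2 x)


/-- A measurable function of at most exponential growth. -/
def ExpGrowth (f : ℝ → ℝ) : Prop :=
  Measurable f ∧ ∃ C c : ℝ, 0 ≤ C ∧ 0 ≤ c ∧ ∀ x, |f x| ≤ C * Real.exp (c * |x|)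

lemma integrable_exp_mul_abs_gaussianReal (c : ℝ) :
    Integrable (fun z : ℝ => Real.exp (c * |z|)) (gaussianReal 0 1) :=
  integrable_exp_mul_abs (X := fun z => z) (integrable_exp_mul_gaussianReal c)
    (integrable_exp_mul_gaussianReal (-c))

lemma exp_mul_abs_affine_le {c b x s z R S : ℝ} (hc : 0 ≤ c) (hx : |x| ≤ R) (hs : |s| ≤ S)
    (hb : S * c ≤ b) :
    Real.exp (c * |x + s * z|) ≤ Real.exp (c * R) * Real.exp (b * |z|) := by
  rw [← Real.exp_add]
  apply Real.exp_le_exp.2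
  have h1 : |x + s * z| ≤ |x| + |s| * |z| := by
    rw [← abs_mul]; exact abs_add_le _ _
  have h2 : |s| * |z| ≤ S * |z| := by gcongr
  have h3 : c * |x + s * z| ≤ c * (R + S * |z|) := by gcongr; linarith
  have h4 : (S * c) * |z| ≤ b * |z| := by gcongr
  linarith

lemma ExpGrowth.integrable {f : ℝ → ℝ} (hf : ExpGrowth f) :
    Integrable f (gaussianReal 0 1) := by
  obtain ⟨hm, C, c, -, -, hb⟩ := hf
  exact ((integrable_exp_mul_abs_gaussianReal c).const_mul C).mono' hm.aestronglyMeasurable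
    (Filter.Eventually.of_forall hb)

lemma ExpGrowth.comp_affine {f : ℝ → ℝ} (hf : ExpGrowth f) (x s : ℝ) :
    ExpGrowth fun z => f (x + s * z) := by
  obtain ⟨hm, C, c, hC, hc, hb⟩ := hf
  refine ⟨hm.comp (by fun_prop), C * Real.exp (c * |x|), |s| * c, by positivity,
    by positivity, fun z => ?_⟩
  rw [mul_assoc]
  exact (hb _).trans (mul_le_mul_of_nonneg_left
    (exp_mul_abs_affine_le hc le_rfl le_rfl le_rfl) hC)

lemma ExpGrowth.integrable_affine {f : ℝ → ℝ} (hf : ExpGrowth f) (x s : ℝ) :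
    Integrable (fun z => f (x + s * z)) (gaussianReal 0 1) :=
  (hf.comp_affine x s).integrable

lemma ExpGrowth.mul {f g : ℝ → ℝ} (hf : ExpGrowth f) (hg : ExpGrowth g) :
    ExpGrowth (fun x => f x * g x) := by
  obtain ⟨hm, C, c, hC, hc, hb⟩ := hf
  obtain ⟨hm', C', c', hC', hc', hb'⟩ := hg
  refine ⟨hm.mul hm', C * C', c + c', by positivity, by positivity, fun x => ?_⟩
  rw [abs_mul, add_mul, Real.exp_add]
  calc |f x| * |g x| ≤ (C * Real.exp (c * |x|)) * (C' * Real.exp (c' * |x|)) := by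
        gcongr
        · exact hb x
        · exact hb' x
    _ = _ := by ring

lemma expGrowth_of_bounded {f : ℝ → ℝ} (hm : Measurable f) {C : ℝ} (hC : ∀ x, |f x| ≤ C) :
    ExpGrowth f :=
  ⟨hm, C, 0, (abs_nonneg _).trans (hC 0), le_rfl, fun x => by simpa using hC x⟩

lemma ExpGrowth.comp_mul_left {f : ℝ → ℝ} (hf : ExpGrowth f) (s : ℝ) :
    ExpGrowth (fun z => f (s * z)) := by
  simpa using hf.comp_affine 0 s

lemma expGrowth_exp_mul (a : ℝ) : ExpGrowth (fun z => Real.exp (a * z)) := by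
  refine ⟨by fun_prop, 1, |a|, zero_le_one, abs_nonneg _, fun z => ?_⟩
  rw [abs_of_pos (Real.exp_pos _), one_mul, ← abs_mul]
  exact Real.exp_le_exp.2 (le_abs_self _)

/-- Differentiation of a Gaussian average along an affine path of means and deviations. -/
lemma hasDerivAt_integral_gaussianReal_affine {f f' : ℝ → ℝ} (hf : ExpGrowth f)
    (hf' : ExpGrowth f') (hd : ∀ x, HasDerivAt f (f' x) x) (a b c d r : ℝ) :
    HasDerivAt (fun r => ∫ z, f ((a * r + b) + (c * r + d) * z) ∂(gaussianReal 0 1))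
      (∫ z, f' ((a * r + b) + (c * r + d) * z) * (a + c * z) ∂(gaussianReal 0 1)) r := by
  have hcf : Continuous f := continuous_iff_continuousAt.2 fun x => (hd x).continuousAt
  obtain ⟨hm, C, k, hC, hk, hb⟩ := id hf'
  set R := |a| * (|r| + 1) + |b| with hR
  set S := |c| * (|r| + 1) + |d| with hS
  have hS0 : 0 ≤ S := by positivity
  refine (hasDerivAt_integral_of_dominated_loc_of_deriv_le
    (F' := fun r z => f' ((a * r + b) + (c * r + d) * z) * (a + c * z))
    (bound := fun z => (C * Real.exp (k * R) * (|a| + |c|)) * Real.exp ((S * k + 1) * |z|))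
    (Metric.ball_mem_nhds r zero_lt_one) ?_ ?_ ?_ ?_ ?_ ?_).2
  · exact Filter.Eventually.of_forall fun x => (hcf.comp (by fun_prop)).aestronglyMeasurable
  · exact hf.integrable_affine _ _
  · exact ((hm.comp (by fun_prop)).mul (by fun_prop)).aestronglyMeasurable
  · refine Filter.Eventually.of_forall fun z x hx => ?_
    have hx1 : |x| ≤ |r| + 1 := by
      have h1 : |x - r| < 1 := by simpa [Real.dist_eq] using hx
      have h2 : |x| ≤ |x - r| + |r| := by simpa using abs_add_le (x - r) r
      linarith
    have e1 : |a * x + b| ≤ R := by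
      refine (abs_add_le _ _).trans ?_
      rw [abs_mul, hR]; gcongr
    have e2 : |c * x + d| ≤ S := by
      refine (abs_add_le _ _).trans ?_
      rw [abs_mul, hS]; gcongr
    have e3 : |f' ((a * x + b) + (c * x + d) * z)| ≤
        C * (Real.exp (k * R) * Real.exp ((S * k) * |z|)) :=
      (hb _).trans (mul_le_mul_of_nonneg_left (exp_mul_abs_affine_le hk e1 e2 le_rfl) hC)
    have e4 : |a + c * z| ≤ (|a| + |c|) * Real.exp |z| := by
      have h1 : |a + c * z| ≤ |a| + |c| * |z| := by
        rw [← abs_mul]; exact abs_add_le _ _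
      have h2 : 1 ≤ Real.exp |z| := Real.one_le_exp (abs_nonneg z)
      have h3 : |z| ≤ Real.exp |z| := by linarith [Real.add_one_le_exp |z|]
      nlinarith [abs_nonneg a, abs_nonneg c]
    rw [Real.norm_eq_abs, abs_mul]
    calc _ ≤ (C * (Real.exp (k * R) * Real.exp ((S * k) * |z|))) *
          ((|a| + |c|) * Real.exp |z|) := by gcongr
      _ = _ := by rw [add_mul (S * k), Real.exp_add, one_mul]; ring
  · exact (integrable_exp_mul_abs_gaussianReal _).const_mul _
  · refine Filter.Eventually.of_forall fun z x _ => ?_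
    refine (hd _).comp x (h₂ := f) ?_
    have h1 : HasDerivAt (fun x => a * x + b) a x := by
      simpa using ((hasDerivAt_id' x).const_mul a).add_const b
    have h2 : HasDerivAt (fun x => (c * x + d) * z) (c * z) x := by
      simpa using (((hasDerivAt_id' x).const_mul c).add_const d).mul_const z
    exact h1.add h2

lemma continuous_integral_gaussianReal_affine {f : ℝ → ℝ} (hf : ExpGrowth f)
    (hcf : Continuous f) :
    Continuous (fun p : ℝ × ℝ => ∫ z, f (p.1 + p.2 * z) ∂(gaussianReal 0 1)) := by
  obtain ⟨hm, C, k, hC, hk, hb⟩ := id hf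
  refine continuous_iff_continuousAt.2 fun p => ?_
  refine continuousAt_of_dominated (bound := fun z => C * (Real.exp (k * (‖p‖ + 1)) *
    Real.exp (((‖p‖ + 1) * k) * |z|))) ?_ ?_ ?_ ?_
  · exact Filter.Eventually.of_forall fun q => (hcf.comp (by fun_prop)).aestronglyMeasurable
  · filter_upwards [Metric.ball_mem_nhds p zero_lt_one] with q hq
    refine Filter.Eventually.of_forall fun z => ?_
    have hq1 : ‖q‖ ≤ ‖p‖ + 1 := by
      have h1 : ‖q - p‖ < 1 := by simpa [dist_eq_norm] using hq
      have h2 : ‖q‖ ≤ ‖q - p‖ + ‖p‖ := by simpa using norm_add_le (q - p) p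
      linarith
    exact (hb _).trans (mul_le_mul_of_nonneg_left (exp_mul_abs_affine_le hk
      ((norm_fst_le q).trans hq1) ((norm_snd_le q).trans hq1) le_rfl) hC)
  · exact ((integrable_exp_mul_abs_gaussianReal _).const_mul _).const_mul _
  · exact Filter.Eventually.of_forall fun z => (hcf.comp (by fun_prop)).continuousAt

lemma integrable_gaussianReal_iff_volume {g : ℝ → ℝ} :
    Integrable g (gaussianReal 0 1) ↔ Integrable (fun z => gaussianPDFReal 0 1 z * g z) := by
  rw [gaussianReal_of_var_ne_zero _ one_ne_zero, gaussianPDF_def,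
    integrable_withDensity_iff_integrable_smul₀' (by fun_prop) (by simp)]
  simp [ENNReal.toReal_ofReal, gaussianPDFReal_nonneg]

/-- Gaussian integration by parts. -/
lemma integral_mul_gaussianReal_eq_integral_deriv {g g' : ℝ → ℝ} (hg : ExpGrowth g)
    (hg' : ExpGrowth g') (hd : ∀ x, HasDerivAt g (g' x) x) :
    ∫ z, g z * z ∂(gaussianReal 0 1) = ∫ z, g' z ∂(gaussianReal 0 1) := by
  have hid : ExpGrowth (fun z : ℝ => z) :=
    ⟨measurable_id, 1, 1, zero_le_one, zero_le_one, fun z => by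
      linarith [Real.add_one_le_exp (1 * |z|)]⟩
  have hpd : ∀ z, HasDerivAt (gaussianPDFReal 0 1) (-(z * gaussianPDFReal 0 1 z)) z := by
    intro z
    have h1 : HasDerivAt (fun z : ℝ => -(z - 0) ^ 2 / (2 * ((1 : NNReal) : ℝ))) (-z) z := by
      have h := (((hasDerivAt_id' z).sub_const 0).fun_pow 2).fun_neg.div_const
        (2 * ((1 : NNReal) : ℝ))
      refine h.congr_deriv ?_
      simp
      ring
    have h2 := h1.exp.const_mul (Real.sqrt (2 * Real.pi * ((1 : NNReal) : ℝ)))⁻¹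
    rw [gaussianPDFReal_def]
    refine h2.congr_deriv ?_
    ring
  have i1 := integrable_gaussianReal_iff_volume.1 (hg.mul hid).integrable
  have i2 := integrable_gaussianReal_iff_volume.1 hg'.integrable
  have i3 := integrable_gaussianReal_iff_volume.1 hg.integrable
  rw [integral_gaussianReal_eq_integral_smul one_ne_zero,
    integral_gaussianReal_eq_integral_smul one_ne_zero]
  have key := integral_mul_deriv_eq_deriv_mul_of_integrable (u := g) (u' := g')
    (v := gaussianPDFReal 0 1) (v' := fun z => -(z * gaussianPDFReal 0 1 z))
    (fun x _ => hd x) (fun x _ => hpd x)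
    (i1.neg.congr (Filter.Eventually.of_forall fun z => by simp; ring))
    (i2.congr (Filter.Eventually.of_forall fun z => by simp; ring))
    (i3.congr (Filter.Eventually.of_forall fun z => by simp; ring))
  have e1 : ∫ z, gaussianPDFReal 0 1 z • (g z * z) =
      -∫ z, g z * -(z * gaussianPDFReal 0 1 z) := by
    rw [← integral_neg]; congr 1; ext z; simp; ring
  rw [e1, key, neg_neg]
  congr 1; ext z; simp; ring

lemma nonpos_of_isLocalMax_of_hasDerivAt_deriv {g g' : ℝ → ℝ} {x c : ℝ}
    (hd : ∀ y, HasDerivAt g (g' y) y) (h2 : HasDerivAt g' c x) (hmax : IsLocalMax g x) :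
    c ≤ 0 := by
  by_contra! hc
  have hg : deriv g = g' := funext fun y => (hd y).deriv
  have hmin : IsLocalMin g x :=
    isLocalMin_of_deriv_deriv_pos (by rw [hg, h2.deriv]; exact hc) hmax.deriv_eq_zero
      (hd x).continuousAt
  have hconst : g =ᶠ[nhds x] fun _ => g x := by
    filter_upwards [hmin, hmax] with y h1 h2 using le_antisymm h2 h1
  have h3 : g' =ᶠ[nhds x] fun _ => 0 := by
    have := hconst.deriv
    rw [hg] at this
    filter_upwards [this] with y hy
    simpa using hy
  have h4 := (h2.congr_of_eventuallyEq h3.symm).unique (hasDerivAt_const x (0 : ℝ))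
  exact hc.ne' h4

lemma nonneg_of_hasDerivAt_of_forall_le_right_endpoint {h : ℝ → ℝ} {d t : ℝ} (ht : 0 < t)
    (hd : HasDerivAt h d t) (hmax : ∀ s ∈ Icc 0 t, h s ≤ h t) : 0 ≤ d := by
  refine ge_of_tendsto hd.tendsto_slope_zero_left ?_
  have h1 : ∀ᶠ y : ℝ in nhdsWithin 0 (Iio 0), -t < y :=
    nhdsWithin_le_nhds (lt_mem_nhds (by linarith))
  filter_upwards [h1, self_mem_nhdsWithin] with y hy hy0
  have hy0' : y < 0 := hy0
  have h2 := hmax (t + y) ⟨by linarith, by linarith⟩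
  exact mul_nonneg_of_nonpos_of_nonpos (inv_nonpos.2 hy0'.le) (by linarith)

/-- A maximum principle on the line for subsolutions of a heat equation with bounded drift. -/
lemma parabolic_maximum_principle {D Dx : ℝ → ℝ → ℝ} {A B M : ℝ} (hM : 0 ≤ M)
    (hcont : Continuous fun p : ℝ × ℝ => D p.1 p.2)
    (hgrow : ∀ x, ∀ t ∈ Icc (0 : ℝ) 1, D x t ≤ A + B * |x|)
    (h0 : ∀ x, D x 0 ≤ 0)
    (hx : ∀ t x, HasDerivAt (fun y => D y t) (Dx x t) x)
    (hpde : ∀ x t, 0 < t → ∃ Dxx Dt, HasDerivAt (fun y => Dx y t) Dxx x ∧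
      HasDerivAt (fun s => D x s) Dt t ∧ Dt ≤ 1 / 2 * Dxx + M * |Dx x t|) :
    ∀ x, ∀ t ∈ Icc (0 : ℝ) 1, D x t ≤ 0 := by
  set K := 2 + 2 * M with hK
  have main : ∀ ε > 0, ∀ x, ∀ t ∈ Icc (0 : ℝ) 1,
      D x t - ε * ((1 + x ^ 2) * Real.exp (K * t)) ≤ 0 := by
    intro ε hε x₁ t₁ ht₁
    by_contra! hpos
    set R := (|A| + |B|) / ε + 1 + |x₁| with hR
    have hR1 : 1 ≤ R := by
      have : 0 ≤ (|A| + |B|) / ε := by positivity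
      have := abs_nonneg x₁
      linarith
    have hRx : |x₁| ≤ R := by
      have : 0 ≤ (|A| + |B|) / ε := by positivity
      linarith
    have hout : ∀ x, ∀ t ∈ Icc (0 : ℝ) 1, R ≤ |x| →
        D x t - ε * ((1 + x ^ 2) * Real.exp (K * t)) ≤ 0 := by
      intro x t ht hxR
      have e1 : 1 ≤ Real.exp (K * t) := Real.one_le_exp (mul_nonneg (by positivity) ht.1)
      have e2 : (1 + x ^ 2) * 1 ≤ (1 + x ^ 2) * Real.exp (K * t) := by gcongr
      have e3 : ε * ((1 + x ^ 2) * 1) ≤ ε * ((1 + x ^ 2) * Real.exp (K * t)) := by gcongr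
      have e4 : |A| + |B| ≤ ε * |x| := by
        have : (|A| + |B|) / ε ≤ |x| := by linarith [abs_nonneg x₁]
        rwa [div_le_iff₀ hε, mul_comm] at this
      have e5 : (|A| + |B|) * |x| ≤ ε * |x| * |x| := by gcongr
      have e6 : ε * |x| * |x| = ε * x ^ 2 := by rw [mul_assoc, abs_mul_abs_self, sq]
      have e7 : |A| * 1 ≤ |A| * |x| := by gcongr; linarith
      have e8 : B * |x| ≤ |B| * |x| := by gcongr; exact le_abs_self B
      linarith [hgrow x t ht, le_abs_self A]
    have hcompact : IsCompact (Icc (-R) R ×ˢ Icc (0 : ℝ) 1) := isCompact_Icc.prod isCompact_Icc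
    obtain ⟨⟨x₀, t₀⟩, ⟨hx₀, ht₀⟩, hmax⟩ := hcompact.exists_isMaxOn
      ⟨(x₁, t₁), ⟨abs_le.1 hRx, ht₁⟩⟩
      (f := fun p : ℝ × ℝ => D p.1 p.2 - ε * ((1 + p.1 ^ 2) * Real.exp (K * p.2)))
      (by fun_prop)
    have hmax' : ∀ x ∈ Icc (-R) R, ∀ t ∈ Icc (0 : ℝ) 1,
        D x t - ε * ((1 + x ^ 2) * Real.exp (K * t)) ≤
          D x₀ t₀ - ε * ((1 + x₀ ^ 2) * Real.exp (K * t₀)) :=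
      fun x hx t ht => hmax (show (x, t) ∈ _ from ⟨hx, ht⟩)
    simp only at hx₀ ht₀
    have hpos₀ : 0 < D x₀ t₀ - ε * ((1 + x₀ ^ 2) * Real.exp (K * t₀)) :=
      hpos.trans_le (hmax' x₁ (abs_le.1 hRx) t₁ ht₁)
    have hx₀R : |x₀| < R := by
      by_contra! hc
      exact absurd (hout x₀ t₀ ht₀ hc) (not_le.2 hpos₀)
    have ht₀pos : 0 < t₀ := by
      refine lt_of_le_of_ne ht₀.1 fun hc => ?_
      rw [← hc] at hpos₀
      have : 0 ≤ ε * ((1 + x₀ ^ 2) * Real.exp (K * 0)) := by positivity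
      linarith [h0 x₀]
    obtain ⟨Dxx, Dt, hDxx, hDt, hle⟩ := hpde x₀ t₀ ht₀pos
    set e := Real.exp (K * t₀) with he
    have hepos : 0 < e := Real.exp_pos _
    have hlm : IsLocalMax (fun y => D y t₀ - ε * ((1 + y ^ 2) * e)) x₀ := by
      filter_upwards [Ioo_mem_nhds (abs_lt.1 hx₀R).1 (abs_lt.1 hx₀R).2] with y hy
      exact hmax' y ⟨hy.1.le, hy.2.le⟩ t₀ ht₀
    have hd1 : ∀ y, HasDerivAt (fun y => D y t₀ - ε * ((1 + y ^ 2) * e))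
        (Dx y t₀ - ε * (2 * y * e)) y := by
      intro y
      have h1 : HasDerivAt (fun y : ℝ => ε * ((1 + y ^ 2) * e)) (ε * (2 * y * e)) y := by
        have := ((((hasDerivAt_id' y).fun_pow 2).const_add 1).mul_const e).const_mul ε
        simpa using this
      exact (hx t₀ y).sub h1
    have hd2 : HasDerivAt (fun y => Dx y t₀ - ε * (2 * y * e)) (Dxx - ε * (2 * e)) x₀ := by
      have h1 : HasDerivAt (fun y : ℝ => ε * (2 * y * e)) (ε * (2 * e)) x₀ := by
        have := (((hasDerivAt_id' x₀).const_mul 2).mul_const e).const_mul ε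
        simpa using this
      exact hDxx.sub h1
    have hd3 : HasDerivAt (fun s => D x₀ s - ε * ((1 + x₀ ^ 2) * Real.exp (K * s)))
        (Dt - ε * ((1 + x₀ ^ 2) * (e * K))) t₀ := by
      have h1 : HasDerivAt (fun s : ℝ => ε * ((1 + x₀ ^ 2) * Real.exp (K * s)))
          (ε * ((1 + x₀ ^ 2) * (e * K))) t₀ := by
        have := ((((hasDerivAt_id' t₀).const_mul K).exp).const_mul (1 + x₀ ^ 2)).const_mul ε
        simpa using this
      exact hDt.sub h1
    have c1 : Dx x₀ t₀ - ε * (2 * x₀ * e) = 0 := hlm.hasDerivAt_eq_zero (hd1 x₀)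
    have c2 := nonpos_of_isLocalMax_of_hasDerivAt_deriv hd1 hd2 hlm
    have c3 := nonneg_of_hasDerivAt_of_forall_le_right_endpoint ht₀pos hd3
      fun s hs => hmax' x₀ hx₀ s ⟨hs.1, hs.2.trans ht₀.2⟩
    have c4 : |Dx x₀ t₀| = ε * e * (2 * |x₀|) := by
      rw [sub_eq_zero.1 c1, abs_mul, abs_mul, abs_mul, abs_of_pos hε, abs_of_pos hepos, abs_two]
      ring
    have c5 : 2 * |x₀| ≤ 1 + x₀ ^ 2 := by nlinarith [sq_nonneg (|x₀| - 1), sq_abs x₀]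
    have c6 : M * (ε * e * (2 * |x₀|)) ≤ M * (ε * e * (1 + x₀ ^ 2)) := by gcongr
    have c7 : 0 < ε * e := by positivity
    have c8 : 0 ≤ M * (ε * e * (1 + x₀ ^ 2)) := by positivity
    have c9 : 0 ≤ ε * e * x₀ ^ 2 := by positivity
    rw [c4] at hle
    rw [hK] at c3
    nlinarith
  intro x t ht
  by_contra! hc
  set q := (1 + x ^ 2) * Real.exp (K * t) with hq
  have hqpos : 0 < q := by positivity
  have h1 := main (D x t / (2 * q)) (by positivity) x t ht
  have h2 : D x t / (2 * q) * q = D x t / 2 := by field_simp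
  linarith

lemma TwiceDiffBounded.abs_le {φ : ℝ → ℝ} (hφ : TwiceDiffBounded φ) {L : ℝ}
    (hL : ∀ x, |deriv φ x| ≤ L) (x : ℝ) : |φ x| ≤ |φ 0| + L * |x| := by
  have h := convex_univ.norm_image_sub_le_of_norm_deriv_le (f := φ) (C := L) (x := 0) (y := x)
    (fun y _ => hφ.1 y) (fun y _ => hL y) (mem_univ _) (mem_univ _)
  simp only [Real.norm_eq_abs, sub_zero] at h
  have h2 : |φ x| ≤ |φ x - φ 0| + |φ 0| := by simpa using abs_add_le (φ x - φ 0) (φ 0)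
  linarith

lemma TwiceDiffBounded.expGrowth_exp {φ : ℝ → ℝ} (hφ : TwiceDiffBounded φ) (m : ℝ) :
    ExpGrowth fun y => Real.exp (m * φ y) := by
  obtain ⟨L, hL⟩ := hφ.2.2.1
  have hL0 : 0 ≤ L := (abs_nonneg _).trans (hL 0)
  have hm := hφ.1.continuous
  refine ⟨by fun_prop, Real.exp (|m| * |φ 0|), |m| * L, by positivity, by positivity,
    fun x => ?_⟩
  rw [abs_of_pos (Real.exp_pos _), ← Real.exp_add]
  apply Real.exp_le_exp.2
  calc m * φ x ≤ |m| * |φ x| := by rw [← abs_mul]; exact le_abs_self _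
    _ ≤ |m| * (|φ 0| + L * |x|) := by gcongr; exact hφ.abs_le hL x
    _ = _ := by ring

lemma TwiceDiffBounded.expGrowth_deriv {φ : ℝ → ℝ} (hφ : TwiceDiffBounded φ) :
    ExpGrowth (deriv φ) :=
  expGrowth_of_bounded (measurable_deriv φ) hφ.2.2.1.choose_spec

lemma TwiceDiffBounded.expGrowth_deriv_deriv {φ : ℝ → ℝ} (hφ : TwiceDiffBounded φ) :
    ExpGrowth (deriv (deriv φ)) :=
  expGrowth_of_bounded (measurable_deriv _) hφ.2.2.2.choose_spec

lemma TwiceDiffBounded.expGrowth_deriv_mul_exp {φ : ℝ → ℝ} (hφ : TwiceDiffBounded φ) (m : ℝ) :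
    ExpGrowth fun y => deriv φ y * Real.exp (m * φ y) :=
  hφ.expGrowth_deriv.mul (hφ.expGrowth_exp m)

lemma ExpGrowth.add {f g : ℝ → ℝ} (hf : ExpGrowth f) (hg : ExpGrowth g) :
    ExpGrowth (fun x => f x + g x) := by
  obtain ⟨hm, C, c, hC, hc, hb⟩ := hf
  obtain ⟨hm', C', c', hC', hc', hb'⟩ := hg
  refine ⟨hm.add hm', C + C', c + c', by positivity, by positivity, fun x => ?_⟩
  have h1 : Real.exp (c * |x|) ≤ Real.exp ((c + c') * |x|) := by
    gcongr; linarith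
  have h2 : Real.exp (c' * |x|) ≤ Real.exp ((c + c') * |x|) := by
    gcongr; linarith
  calc |f x + g x| ≤ |f x| + |g x| := abs_add_le _ _
    _ ≤ C * Real.exp (c * |x|) + C' * Real.exp (c' * |x|) := add_le_add (hb x) (hb' x)
    _ ≤ C * Real.exp ((c + c') * |x|) + C' * Real.exp ((c + c') * |x|) := by gcongr
    _ = _ := by ring

lemma ExpGrowth.const_mul {f : ℝ → ℝ} (hf : ExpGrowth f) (a : ℝ) :
    ExpGrowth (fun x => a * f x) :=
  (expGrowth_of_bounded (f := fun _ => a) measurable_const fun _ => le_rfl).mul hf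

/-- The average of `deriv φ` under the tilted Gaussian law appearing in `parisiF`. -/
noncomputable def parisiSlope (φ : ℝ → ℝ) (m x s : ℝ) : ℝ :=
  (∫ z, deriv φ (x + s * z) * Real.exp (m * φ (x + s * z)) ∂(gaussianReal 0 1)) /
    ∫ z, Real.exp (m * φ (x + s * z)) ∂(gaussianReal 0 1)

lemma TwiceDiffBounded.integral_exp_affine_pos {φ : ℝ → ℝ} (hφ : TwiceDiffBounded φ) (m x s : ℝ) :
    0 < ∫ z, Real.exp (m * φ (x + s * z)) ∂(gaussianReal 0 1) :=
  integral_exp_pos ((hφ.expGrowth_exp m).integrable_affine x s)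

lemma TwiceDiffBounded.hasDerivAt_exp {φ : ℝ → ℝ} (hφ : TwiceDiffBounded φ) (m y : ℝ) :
    HasDerivAt (fun y => Real.exp (m * φ y)) (m * (deriv φ y * Real.exp (m * φ y))) y :=
  ((hφ.1 y).hasDerivAt.const_mul m).exp.congr_deriv (by ring)

lemma TwiceDiffBounded.hasDerivAt_deriv_mul_exp {φ : ℝ → ℝ} (hφ : TwiceDiffBounded φ)
    (m y : ℝ) :
    HasDerivAt (fun y => deriv φ y * Real.exp (m * φ y))
      (deriv (deriv φ) y * Real.exp (m * φ y) +
        m * (deriv φ y * (deriv φ y * Real.exp (m * φ y)))) y :=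
  ((hφ.2.1 y).hasDerivAt.mul (hφ.hasDerivAt_exp m y)).congr_deriv (by ring)

lemma TwiceDiffBounded.expGrowth_deriv_deriv_mul_exp {φ : ℝ → ℝ} (hφ : TwiceDiffBounded φ)
    (m : ℝ) :
    ExpGrowth fun y => deriv (deriv φ) y * Real.exp (m * φ y) +
        m * (deriv φ y * (deriv φ y * Real.exp (m * φ y))) :=
  (hφ.expGrowth_deriv_deriv.mul (hφ.expGrowth_exp m)).add
    ((hφ.expGrowth_deriv.mul (hφ.expGrowth_deriv_mul_exp m)).const_mul m)

lemma hasDerivAt_integral_gaussianReal_shift {f f' : ℝ → ℝ} (hf : ExpGrowth f)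
    (hf' : ExpGrowth f') (hd : ∀ x, HasDerivAt f (f' x) x) (x s : ℝ) :
    HasDerivAt (fun x => ∫ z, f (x + s * z) ∂(gaussianReal 0 1))
      (∫ z, f' (x + s * z) ∂(gaussianReal 0 1)) x := by
  simpa using hasDerivAt_integral_gaussianReal_affine hf hf' hd 1 0 0 s x

/-- The heat equation for Gaussian averages. -/
lemma hasDerivAt_integral_gaussianReal_sqrt {f f' f'' : ℝ → ℝ} (hf : ExpGrowth f)
    (hf' : ExpGrowth f') (hf'' : ExpGrowth f'') (hd : ∀ x, HasDerivAt f (f' x) x)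
    (hd' : ∀ x, HasDerivAt f' (f'' x) x) (x : ℝ) {t : ℝ} (ht : 0 < t) :
    HasDerivAt (fun t => ∫ z, f (x + √t * z) ∂(gaussianReal 0 1))
      (1 / 2 * ∫ z, f'' (x + √t * z) ∂(gaussianReal 0 1)) t := by
  have h1 := hasDerivAt_integral_gaussianReal_affine hf hf' hd 0 x 1 0 √t
  simp only [zero_mul, zero_add, one_mul, add_zero] at h1
  have h2 := h1.comp t (Real.hasDerivAt_sqrt ht.ne')
  have h3 := integral_mul_gaussianReal_eq_integral_deriv (g := fun z => f' (x + √t * z))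
    (g' := fun z => √t * f'' (x + √t * z)) (hf'.comp_affine x √t)
    ((hf''.comp_affine x √t).const_mul _)
    (fun z => by
      have h := ((hasDerivAt_id' z).const_mul √t).const_add x
      exact ((hd' _).comp z h).congr_deriv (by ring))
  refine h2.congr_deriv ?_
  rw [h3, integral_const_mul]
  have : √t ≠ 0 := (Real.sqrt_pos.2 ht).ne'
  field_simp

lemma TwiceDiffBounded.hasDerivAt_parisiF {φ : ℝ → ℝ} (hφ : TwiceDiffBounded φ) {m : ℝ}
    (hm : m ≠ 0) (x t : ℝ) :
    HasDerivAt (fun y => parisiF φ m y t) (parisiSlope φ m x √t) x := by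
  have h1 := hasDerivAt_integral_gaussianReal_shift (hφ.expGrowth_exp m)
    ((hφ.expGrowth_deriv_mul_exp m).const_mul m) (hφ.hasDerivAt_exp m) x √t
  refine ((h1.log (hφ.integral_exp_affine_pos m x √t).ne').const_mul (1 / m)).congr_deriv ?_
  rw [integral_const_mul, parisiSlope]
  field_simp

/-- The Parisi equation. -/
lemma TwiceDiffBounded.exists_hasDerivAt_parisiF_time {φ : ℝ → ℝ} (hφ : TwiceDiffBounded φ)
    {m : ℝ} (hm : m ≠ 0) (x : ℝ) {t : ℝ} (ht : 0 < t) :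
    ∃ Fxx, HasDerivAt (fun y => parisiSlope φ m y √t) Fxx x ∧
      HasDerivAt (fun s => parisiF φ m x s)
        (1 / 2 * (Fxx + m * parisiSlope φ m x √t ^ 2)) t := by
  have hU := (hφ.integral_exp_affine_pos m x √t).ne'
  have hux := hasDerivAt_integral_gaussianReal_shift (hφ.expGrowth_exp m)
    ((hφ.expGrowth_deriv_mul_exp m).const_mul m) (hφ.hasDerivAt_exp m) x √t
  have hpx := hasDerivAt_integral_gaussianReal_shift (hφ.expGrowth_deriv_mul_exp m)
    (hφ.expGrowth_deriv_deriv_mul_exp m) (hφ.hasDerivAt_deriv_mul_exp m) x √t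
  have hut := hasDerivAt_integral_gaussianReal_sqrt (hφ.expGrowth_exp m)
    ((hφ.expGrowth_deriv_mul_exp m).const_mul m)
    ((hφ.expGrowth_deriv_deriv_mul_exp m).const_mul m) (hφ.hasDerivAt_exp m)
    (fun y => (hφ.hasDerivAt_deriv_mul_exp m y).const_mul m) x ht
  refine ⟨_, hpx.div hux hU, ((hut.log hU).const_mul (1 / m)).congr_deriv ?_⟩
  rw [integral_const_mul, integral_const_mul, parisiSlope]
  field_simp
  ring

lemma TwiceDiffBounded.abs_parisiSlope_le {φ : ℝ → ℝ} (hφ : TwiceDiffBounded φ) {L : ℝ}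
    (hL : ∀ x, |deriv φ x| ≤ L) (m x s : ℝ) : |parisiSlope φ m x s| ≤ L := by
  have hU := hφ.integral_exp_affine_pos m x s
  rw [parisiSlope, abs_div, abs_of_pos hU, div_le_iff₀ hU, ← integral_const_mul]
  refine abs_integral_le_integral_abs.trans (integral_mono
    ((hφ.expGrowth_deriv_mul_exp m).integrable_affine x s).abs
    (((hφ.expGrowth_exp m).integrable_affine x s).const_mul L) fun z => ?_)
  simp only [abs_mul, Real.abs_exp]
  gcongr
  exact hL _

lemma TwiceDiffBounded.continuous_parisiF {φ : ℝ → ℝ} (hφ : TwiceDiffBounded φ) (m : ℝ) :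
    Continuous fun p : ℝ × ℝ => parisiF φ m p.1 p.2 := by
  have hc := hφ.1.continuous
  have h1 := continuous_integral_gaussianReal_affine (hφ.expGrowth_exp m) (by fun_prop)
  have h2 : Continuous fun p : ℝ × ℝ =>
      ∫ z, Real.exp (m * φ (p.1 + √p.2 * z)) ∂(gaussianReal 0 1) :=
    h1.comp (g := fun p : ℝ × ℝ => ∫ z, Real.exp (m * φ (p.1 + p.2 * z)) ∂(gaussianReal 0 1))
      (f := fun p : ℝ × ℝ => (p.1, √p.2)) (by fun_prop)
  exact (h2.log fun p => (hφ.integral_exp_affine_pos m _ _).ne').const_mul (1 / m)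

lemma TwiceDiffBounded.exists_abs_parisiF_le {φ : ℝ → ℝ} (hφ : TwiceDiffBounded φ) {m : ℝ}
    (hm : m ≠ 0) :
    ∃ A B, ∀ x, ∀ t ∈ Icc (0 : ℝ) 1, |parisiF φ m x t| ≤ A + B * |x| := by
  obtain ⟨L, hL⟩ := hφ.2.2.1
  have hc : Continuous fun t => parisiF φ m 0 t :=
    (hφ.continuous_parisiF m).comp (f := fun t : ℝ => ((0 : ℝ), t)) (by fun_prop)
  obtain ⟨A, hA⟩ := isCompact_Icc.exists_bound_of_continuousOn (s := Icc (0 : ℝ) 1)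
    hc.continuousOn
  refine ⟨A, L, fun x t ht => ?_⟩
  have h := convex_univ.norm_image_sub_le_of_norm_hasDerivWithin_le
    (f := fun y => parisiF φ m y t) (C := L) (x := 0) (y := x)
    (fun y _ => (hφ.hasDerivAt_parisiF hm y t).hasDerivWithinAt)
    (fun y _ => hφ.abs_parisiSlope_le hL m y √t) (mem_univ _) (mem_univ _)
  have h' := hA t ht
  simp only [Real.norm_eq_abs, sub_zero] at h h'
  have h2 := abs_add_le (parisiF φ m x t - parisiF φ m 0 t) (parisiF φ m 0 t)
  rw [sub_add_cancel] at h2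
  linarith

lemma parisiF_zero {φ : ℝ → ℝ} {m : ℝ} (hm : m ≠ 0) (x : ℝ) : parisiF φ m x 0 = φ x := by
  simp [parisiF, hm]

/-- Gaussian change of mean. -/
lemma integral_gaussianReal_add_affine {g : ℝ → ℝ} (a s : ℝ) :
    ∫ z, g (s * a + s * z) ∂(gaussianReal 0 1) =
      Real.exp (-(a ^ 2 / 2)) * ∫ z, g (s * z) * Real.exp (a * z) ∂(gaussianReal 0 1) := by
  rw [integral_gaussianReal_eq_integral_smul one_ne_zero,
    integral_gaussianReal_eq_integral_smul one_ne_zero, ← integral_const_mul,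
    ← integral_sub_right_eq_self (μ := volume) _ a]
  congr 1
  ext z
  have h : gaussianPDFReal 0 1 (z - a) =
      gaussianPDFReal 0 1 z * (Real.exp (-(a ^ 2 / 2)) * Real.exp (a * z)) := by
    simp only [gaussianPDFReal_def]
    rw [← Real.exp_add, mul_assoc _ (Real.exp _), ← Real.exp_add]
    congr 2
    simp
    ring
  have h2 : s * a + s * (z - a) = s * z := by ring
  rw [h, h2, smul_eq_mul, smul_eq_mul]
  ring

lemma integral_gaussianReal_neg (h : ℝ → ℝ) :
    ∫ z, h (-z) ∂(gaussianReal 0 1) = ∫ z, h z ∂(gaussianReal 0 1) := by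
  have h1 : (gaussianReal 0 1).map (fun x : ℝ => -x) = gaussianReal 0 1 := by
    simpa using gaussianReal_map_neg (μ := 0) (v := 1)
  conv_rhs => rw [← h1]
  exact (integral_map_equiv (MeasurableEquiv.neg ℝ) h).symm

lemma integral_mul_exp_gaussianReal_of_even {g : ℝ → ℝ} (hg : ExpGrowth g)
    (heven : ∀ z, g (-z) = g z) (a : ℝ) :
    ∫ z, g z * Real.exp (a * z) ∂(gaussianReal 0 1) =
      ∫ z, g z * Real.cosh (a * z) ∂(gaussianReal 0 1) := by
  have i1 := (hg.mul (expGrowth_exp_mul a)).integrable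
  have i2 := (hg.mul (expGrowth_exp_mul (-a))).integrable
  have h := integral_gaussianReal_neg fun z => g z * Real.exp (a * z)
  simp only [heven, mul_neg, ← neg_mul] at h
  have e : ∀ z, g z * Real.cosh (a * z) =
      1 / 2 * (g z * Real.exp (a * z) + g z * Real.exp (-a * z)) := by
    intro z; rw [Real.cosh_eq, neg_mul]; ring
  simp only [e]
  rw [integral_const_mul, integral_add i1 i2, h]
  ring

lemma integral_mul_exp_gaussianReal_of_odd {g : ℝ → ℝ} (hg : ExpGrowth g)
    (hodd : ∀ z, g (-z) = -g z) (a : ℝ) :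
    ∫ z, g z * Real.exp (a * z) ∂(gaussianReal 0 1) =
      ∫ z, g z * Real.sinh (a * z) ∂(gaussianReal 0 1) := by
  have i1 := (hg.mul (expGrowth_exp_mul a)).integrable
  have i2 := (hg.mul (expGrowth_exp_mul (-a))).integrable
  have h := integral_gaussianReal_neg fun z => g z * Real.exp (a * z)
  simp only [hodd, mul_neg, neg_mul, integral_neg] at h
  have e : ∀ z, g z * Real.sinh (a * z) =
      1 / 2 * (g z * Real.exp (a * z) - g z * Real.exp (-a * z)) := by
    intro z; rw [Real.sinh_eq, neg_mul]; ring
  simp only [e]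
  rw [integral_const_mul, integral_sub i1 i2]
  simp only [neg_mul]
  linarith

lemma expGrowth_cosh_mul (a : ℝ) : ExpGrowth fun z => Real.cosh (a * z) := by
  have h := ((expGrowth_exp_mul a).add (expGrowth_exp_mul (-a))).const_mul (1 / 2)
  convert h using 2 with z
  rw [Real.cosh_eq, neg_mul]; ring

lemma expGrowth_sinh_mul (a : ℝ) : ExpGrowth fun z => Real.sinh (a * z) := by
  have h := ((expGrowth_exp_mul a).add ((expGrowth_exp_mul (-a)).const_mul (-1))).const_mul (1 / 2)
  convert h using 2 with z
  rw [Real.sinh_eq, neg_mul]; ring_nf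

lemma deriv_neg_of_even {φ : ℝ → ℝ} (h : ∀ x, φ (-x) = φ x) (x : ℝ) :
    deriv φ (-x) = -deriv φ x := by
  have h1 := deriv_comp_neg φ x
  simp only [h] at h1
  linarith

/-- For an even `φ`, the slope at `s * a` is a ratio of averages of even functions. -/
lemma TwiceDiffBounded.parisiSlope_eq_of_even {φ : ℝ → ℝ} (hφ : TwiceDiffBounded φ)
    (heven : ∀ x, φ (-x) = φ x) (m a s : ℝ) :
    parisiSlope φ m (s * a) s =
      (∫ z, deriv φ (s * z) * Real.exp (m * φ (s * z)) * Real.sinh (a * z) ∂(gaussianReal 0 1)) /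
        ∫ z, Real.exp (m * φ (s * z)) * Real.cosh (a * z) ∂(gaussianReal 0 1) := by
  have h1 := integral_gaussianReal_add_affine
    (g := fun y => deriv φ y * Real.exp (m * φ y)) a s
  have h2 := integral_gaussianReal_add_affine (g := fun y => Real.exp (m * φ y)) a s
  have h3 := integral_mul_exp_gaussianReal_of_odd ((hφ.expGrowth_deriv_mul_exp m).comp_mul_left s)
    (fun z => by simp only [mul_neg, heven, deriv_neg_of_even heven, neg_mul]) a
  have h4 := integral_mul_exp_gaussianReal_of_even ((hφ.expGrowth_exp m).comp_mul_left s)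
    (fun z => by simp only [mul_neg, heven]) a
  rw [parisiSlope, h1, h2, h3, h4, mul_div_mul_left _ _ (Real.exp_pos _).ne']

/-- A symmetrized comparison of products of integrals. -/
lemma integral_mul_integral_le_of_symm {Ω : Type*} [MeasurableSpace Ω] {μ : Measure Ω}
    {p₁ p₂ w₁ w₂ : Ω → ℝ} (hp₁ : Integrable p₁ μ) (hp₂ : Integrable p₂ μ)
    (hw₁ : Integrable w₁ μ) (hw₂ : Integrable w₂ μ)
    (h : ∀ z z', p₁ z * w₂ z' + p₁ z' * w₂ z ≤ p₂ z * w₁ z' + p₂ z' * w₁ z) :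
    (∫ z, p₁ z ∂μ) * ∫ z, w₂ z ∂μ ≤ (∫ z, p₂ z ∂μ) * ∫ z, w₁ z ∂μ := by
  have inner : ∀ z', (∫ z, p₁ z ∂μ) * w₂ z' + p₁ z' * ∫ z, w₂ z ∂μ ≤
      (∫ z, p₂ z ∂μ) * w₁ z' + p₂ z' * ∫ z, w₁ z ∂μ := by
    intro z'
    have := integral_mono ((hp₁.mul_const (w₂ z')).add (hw₂.const_mul (p₁ z')))
      ((hp₂.mul_const (w₁ z')).add (hw₁.const_mul (p₂ z'))) fun z => h z z'
    simpa only [Pi.add_apply, integral_add (hp₁.mul_const (w₂ z')) (hw₂.const_mul (p₁ z')),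
      integral_add (hp₂.mul_const (w₁ z')) (hw₁.const_mul (p₂ z')), integral_mul_const,
      integral_const_mul] using this
  have i1 := hw₂.const_mul (∫ z, p₁ z ∂μ)
  have i2 := hp₁.mul_const (∫ z, w₂ z ∂μ)
  have i3 := hw₁.const_mul (∫ z, p₂ z ∂μ)
  have i4 := hp₂.mul_const (∫ z, w₁ z ∂μ)
  have outer := integral_mono (i1.add i2) (i3.add i4) inner
  simp only [Pi.add_apply, integral_add i1 i2, integral_add i3 i4, integral_mul_const,
    integral_const_mul] at outer
  linarith

lemma AdmissibleEvenPair.deriv_nonneg {φ1 φ2 : ℝ → ℝ} (h : AdmissibleEvenPair φ1 φ2) :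
    MonotoneOn (deriv φ1) univ ∧ ∀ x, 0 ≤ x → 0 ≤ deriv φ1 x := by
  obtain ⟨h1, -, e1, -, c1, -⟩ := h
  have hmono : MonotoneOn (deriv φ1) univ := c1.monotoneOn_deriv fun x _ => h1.1 x
  refine ⟨hmono, fun x hx => ?_⟩
  have h0 := deriv_neg_of_even e1 0
  rw [neg_zero] at h0
  have := hmono (mem_univ 0) (mem_univ x) hx
  linarith

lemma AdmissibleEvenPair.monotoneOn_sub {φ1 φ2 : ℝ → ℝ} (h : AdmissibleEvenPair φ1 φ2)
    {m1 m2 : ℝ} (hm1 : 0 < m1) (hm12 : m1 ≤ m2) :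
    MonotoneOn (fun y => m2 * φ2 y - m1 * φ1 y) (Ici 0) := by
  have hd1 := h.1.1
  have hd2 := h.2.1.1
  have hc1 := hd1.continuous
  have hc2 := hd2.continuous
  refine monotoneOn_of_deriv_nonneg (convex_Ici 0) (by fun_prop) (by fun_prop) fun x hx => ?_
  rw [interior_Ici] at hx
  have hx0 : 0 ≤ x := le_of_lt hx
  have h1 := h.deriv_nonneg.2 x hx0
  have h2 := h.2.2.2.2.2.2.2 x hx0
  rw [deriv_fun_sub (by fun_prop) (by fun_prop), deriv_const_mul_field, deriv_const_mul_field]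
  nlinarith

lemma AdmissibleEvenPair.slope_kernel_le_of_le {φ1 φ2 : ℝ → ℝ} (h : AdmissibleEvenPair φ1 φ2)
    {m1 m2 : ℝ} (hm1 : 0 < m1) (hm12 : m1 ≤ m2) {a s z z' : ℝ} (ha : 0 ≤ a) (hs : 0 ≤ s)
    (hz' : 0 ≤ z') (hzz : z' ≤ z) :
    deriv φ1 (s * z) * Real.exp (m1 * φ1 (s * z)) * Real.sinh (a * z) *
          (Real.exp (m2 * φ2 (s * z')) * Real.cosh (a * z')) +
        deriv φ1 (s * z') * Real.exp (m1 * φ1 (s * z')) * Real.sinh (a * z') *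
          (Real.exp (m2 * φ2 (s * z)) * Real.cosh (a * z)) ≤
      deriv φ2 (s * z) * Real.exp (m2 * φ2 (s * z)) * Real.sinh (a * z) *
          (Real.exp (m1 * φ1 (s * z')) * Real.cosh (a * z')) +
        deriv φ2 (s * z') * Real.exp (m2 * φ2 (s * z')) * Real.sinh (a * z') *
          (Real.exp (m1 * φ1 (s * z)) * Real.cosh (a * z)) := by
  have hz : 0 ≤ z := hz'.trans hzz
  have hsz : 0 ≤ s * z := by positivity
  have hsz' : 0 ≤ s * z' := by positivity
  have hle : s * z' ≤ s * z := by gcongr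
  have d0 := h.deriv_nonneg.2 _ hsz'
  have d1 := h.deriv_nonneg.1 (mem_univ _) (mem_univ _) hle
  have d2 := h.2.2.2.2.2.2.2 _ hsz
  have d2' := h.2.2.2.2.2.2.2 _ hsz'
  have hS : 0 ≤ Real.sinh (a * z) := Real.sinh_nonneg_iff.2 (by positivity)
  have hS' : 0 ≤ Real.sinh (a * z') := Real.sinh_nonneg_iff.2 (by positivity)
  have hC := Real.cosh_pos (a * z)
  have hC' := Real.cosh_pos (a * z')
  have hSC : Real.sinh (a * z') * Real.cosh (a * z) ≤ Real.sinh (a * z) * Real.cosh (a * z') := by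
    have h1 : 0 ≤ Real.sinh (a * z - a * z') :=
      Real.sinh_nonneg_iff.2 (by rw [← mul_sub]; exact mul_nonneg ha (by linarith))
    rw [Real.sinh_sub] at h1
    linarith
  have hE : Real.exp (m1 * φ1 (s * z)) * Real.exp (m2 * φ2 (s * z')) ≤
      Real.exp (m2 * φ2 (s * z)) * Real.exp (m1 * φ1 (s * z')) := by
    rw [← Real.exp_add, ← Real.exp_add]
    apply Real.exp_le_exp.2
    have := h.monotoneOn_sub hm1 hm12 (mem_Ici.2 hsz') (mem_Ici.2 hsz) hle
    simp only at this
    linarith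
  have p1 := Real.exp_pos (m1 * φ1 (s * z))
  have p2 := Real.exp_pos (m2 * φ2 (s * z))
  have p1' := Real.exp_pos (m1 * φ1 (s * z'))
  have p2' := Real.exp_pos (m2 * φ2 (s * z'))
  generalize Real.exp (m1 * φ1 (s * z)) = e1 at *
  generalize Real.exp (m2 * φ2 (s * z)) = e2 at *
  generalize Real.exp (m1 * φ1 (s * z')) = e1' at *
  generalize Real.exp (m2 * φ2 (s * z')) = e2' at *
  generalize Real.sinh (a * z) = S at *
  generalize Real.sinh (a * z') = S' at *
  generalize Real.cosh (a * z) = C at *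
  generalize Real.cosh (a * z') = C' at *
  generalize deriv φ1 (s * z) = u at *
  generalize deriv φ1 (s * z') = u' at *
  generalize deriv φ2 (s * z) = v at *
  generalize deriv φ2 (s * z') = v' at *
  have k1 : u * e2 * S * (e1' * C') ≤ v * e2 * S * (e1' * C') := by gcongr
  have k2 : u' * e2' * S' * (e1 * C) ≤ v' * e2' * S' * (e1 * C) := by gcongr
  have k3 : u' * (S' * C) ≤ u * (S * C') :=
    mul_le_mul d1 hSC (by positivity) (d0.trans d1)
  nlinarith [mul_nonneg (sub_nonneg.2 hE) (sub_nonneg.2 k3)]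

lemma AdmissibleEvenPair.slope_kernel_le {φ1 φ2 : ℝ → ℝ} (h : AdmissibleEvenPair φ1 φ2)
    {m1 m2 : ℝ} (hm1 : 0 < m1) (hm12 : m1 ≤ m2) {a s : ℝ} (ha : 0 ≤ a) (hs : 0 ≤ s)
    (z z' : ℝ) :
    deriv φ1 (s * z) * Real.exp (m1 * φ1 (s * z)) * Real.sinh (a * z) *
          (Real.exp (m2 * φ2 (s * z')) * Real.cosh (a * z')) +
        deriv φ1 (s * z') * Real.exp (m1 * φ1 (s * z')) * Real.sinh (a * z') *
          (Real.exp (m2 * φ2 (s * z)) * Real.cosh (a * z)) ≤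
      deriv φ2 (s * z) * Real.exp (m2 * φ2 (s * z)) * Real.sinh (a * z) *
          (Real.exp (m1 * φ1 (s * z')) * Real.cosh (a * z')) +
        deriv φ2 (s * z') * Real.exp (m2 * φ2 (s * z')) * Real.sinh (a * z') *
          (Real.exp (m1 * φ1 (s * z)) * Real.cosh (a * z)) := by
  wlog hz : 0 ≤ z generalizing z
  · have := this (-z) (by linarith)
    simpa only [mul_neg, h.2.2.1 _, h.2.2.2.1 _, deriv_neg_of_even h.2.2.1,
      deriv_neg_of_even h.2.2.2.1, Real.sinh_neg, Real.cosh_neg, neg_mul, neg_neg] using this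
  wlog hz' : 0 ≤ z' generalizing z'
  · have := this (-z') (by linarith)
    simpa only [mul_neg, h.2.2.1 _, h.2.2.2.1 _, deriv_neg_of_even h.2.2.1,
      deriv_neg_of_even h.2.2.2.1, Real.sinh_neg, Real.cosh_neg, neg_mul, neg_neg] using this
  rcases le_total z' z with hle | hle
  · exact h.slope_kernel_le_of_le hm1 hm12 ha hs hz' hle
  · have := h.slope_kernel_le_of_le hm1 hm12 ha hs hz hle
    linarith

/-- The slopes of an admissible even pair stay ordered in absolute value. -/
lemma AdmissibleEvenPair.sq_parisiSlope_le {φ1 φ2 : ℝ → ℝ} (h : AdmissibleEvenPair φ1 φ2)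
    {m1 m2 : ℝ} (hm1 : 0 < m1) (hm12 : m1 ≤ m2) {s : ℝ} (hs : 0 < s) (x : ℝ) :
    parisiSlope φ1 m1 x s ^ 2 ≤ parisiSlope φ2 m2 x s ^ 2 := by
  obtain ⟨a, rfl⟩ : ∃ a, x = s * a := ⟨x / s, by field_simp⟩
  rw [h.1.parisiSlope_eq_of_even h.2.2.1, h.2.1.parisiSlope_eq_of_even h.2.2.2.1]
  wlog ha : 0 ≤ a generalizing a
  · have := this (-a) (by linarith)
    simpa only [neg_mul, Real.sinh_neg, Real.cosh_neg, mul_neg, integral_neg, neg_div, neg_sq]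
      using this
  have ip : ∀ {φ : ℝ → ℝ} (hφ : TwiceDiffBounded φ) (m : ℝ), Integrable (fun z =>
      deriv φ (s * z) * Real.exp (m * φ (s * z)) * Real.sinh (a * z)) (gaussianReal 0 1) :=
    fun hφ m => (((hφ.expGrowth_deriv_mul_exp m).comp_mul_left s).mul
      (expGrowth_sinh_mul a)).integrable
  have iw : ∀ {φ : ℝ → ℝ} (hφ : TwiceDiffBounded φ) (m : ℝ), Integrable (fun z =>
      Real.exp (m * φ (s * z)) * Real.cosh (a * z)) (gaussianReal 0 1) :=
    fun hφ m => (((hφ.expGrowth_exp m).comp_mul_left s).mul (expGrowth_cosh_mul a)).integrable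
  have wpos : ∀ {φ : ℝ → ℝ} (hφ : TwiceDiffBounded φ) (m : ℝ),
      0 < ∫ z, Real.exp (m * φ (s * z)) * Real.cosh (a * z) ∂(gaussianReal 0 1) := by
    intro φ hφ m
    have h1 : 0 < ∫ z, Real.exp (m * φ (0 + s * z)) ∂(gaussianReal 0 1) :=
      hφ.integral_exp_affine_pos m 0 s
    simp only [zero_add] at h1
    refine h1.trans_le (integral_mono ((hφ.expGrowth_exp m).comp_mul_left s).integrable
      (iw hφ m) fun z => ?_)
    exact le_mul_of_one_le_right (Real.exp_pos _).le (Real.one_le_cosh _)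
  have key := integral_mul_integral_le_of_symm (ip h.1 m1) (ip h.2.1 m2) (iw h.1 m1)
    (iw h.2.1 m2) (h.slope_kernel_le hm1 hm12 ha hs.le)
  refine pow_le_pow_left₀ (div_nonneg (integral_nonneg fun z => ?_) (wpos h.1 m1).le)
    ((div_le_div_iff₀ (wpos h.1 m1) (wpos h.2.1 m2)).2 key) 2
  simp only [Pi.zero_apply]
  rcases le_total 0 z with hz | hz
  · exact mul_nonneg (mul_nonneg (h.deriv_nonneg.2 _ (by positivity)) (Real.exp_pos _).le)
      (Real.sinh_nonneg_iff.2 (by positivity))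
  · have h1 := h.deriv_nonneg.2 (s * -z) (mul_nonneg hs.le (by linarith))
    rw [mul_neg, deriv_neg_of_even h.2.2.1] at h1
    exact mul_nonneg_of_nonpos_of_nonpos
      (mul_nonpos_of_nonpos_of_nonneg (by linarith) (Real.exp_pos _).le)
      (Real.sinh_nonpos_iff.2 (mul_nonpos_of_nonneg_of_nonpos ha hz))

lemma TwiceDiffBounded.convex_comb {φ1 φ2 : ℝ → ℝ} (h1 : TwiceDiffBounded φ1)
    (h2 : TwiceDiffBounded φ2) (a b : ℝ) : TwiceDiffBounded fun y => a * φ1 y + b * φ2 y := by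
  obtain ⟨d1, dd1, ⟨C1, hC1⟩, ⟨E1, hE1⟩⟩ := h1
  obtain ⟨d2, dd2, ⟨C2, hC2⟩, ⟨E2, hE2⟩⟩ := h2
  have bound : ∀ {u v C E : ℝ}, |u| ≤ C → |v| ≤ E → |a * u + b * v| ≤ |a| * C + |b| * E := by
    intro u v C E hu hv
    refine (abs_add_le _ _).trans ?_
    rw [abs_mul, abs_mul]
    gcongr
  have e1 : deriv (fun y => a * φ1 y + b * φ2 y) = fun y => a * deriv φ1 y + b * deriv φ2 y :=
    funext fun y => (((d1 y).hasDerivAt.const_mul a).add ((d2 y).hasDerivAt.const_mul b)).deriv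
  have e2 : deriv (fun y => a * deriv φ1 y + b * deriv φ2 y) =
      fun y => a * deriv (deriv φ1) y + b * deriv (deriv φ2) y :=
    funext fun y => (((dd1 y).hasDerivAt.const_mul a).add ((dd2 y).hasDerivAt.const_mul b)).deriv
  refine ⟨by fun_prop, ?_, ⟨|a| * C1 + |b| * C2, fun x => ?_⟩, ⟨|a| * E1 + |b| * E2, fun x => ?_⟩⟩
  · rw [e1]; fun_prop
  · rw [e1]; exact bound (hC1 x) (hC2 x)
  · rw [e1, e2]; exact bound (hE1 x) (hE2 x)

lemma weighted_sq_le {α m1 m2 a b : ℝ} (hα : α ∈ Icc (0 : ℝ) 1) (hm1 : 0 < m1) (hm12 : m1 ≤ m2)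
    (hab : a ^ 2 ≤ b ^ 2) :
    (α * m1 + (1 - α) * m2) * (α * a + (1 - α) * b) ^ 2 ≤
      α * (m1 * a ^ 2) + (1 - α) * (m2 * b ^ 2) := by
  have h0 : 0 ≤ 1 - α := sub_nonneg.2 hα.2
  have hw : 0 ≤ α * (1 - α) := mul_nonneg hα.1 h0
  have hn : 0 ≤ α * m1 + (1 - α) * m2 :=
    add_nonneg (mul_nonneg hα.1 hm1.le) (mul_nonneg h0 (hm1.le.trans hm12))
  have j1 := mul_nonneg hn (mul_nonneg hw (sq_nonneg (a - b)))
  have j2 := mul_nonneg hw (mul_nonneg (sub_nonneg.2 hm12) (sub_nonneg.2 hab))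
  linear_combination j1 + j2

theorem parisi_convexity_even (φ1 φ2 : ℝ → ℝ) (h : AdmissibleEvenPair φ1 φ2)
    (m1 m2 : ℝ) (hm1 : 0 < m1) (hm12 : m1 ≤ m2)
    (α : ℝ) (hα : α ∈ Set.Icc (0 : ℝ) 1) :
    ∀ x : ℝ, ∀ t ∈ Set.Icc (0 : ℝ) 1,
      parisiF (fun y => α * φ1 y + (1 - α) * φ2 y) (α * m1 + (1 - α) * m2) x t
        ≤ α * parisiF φ1 m1 x t + (1 - α) * parisiF φ2 m2 x t := by
  have hn : 0 < α * m1 + (1 - α) * m2 := by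
    nlinarith [mul_nonneg (sub_nonneg.2 hα.2) (sub_nonneg.2 hm12)]
  have hm2 : 0 < m2 := hm1.trans_le hm12
  set n := α * m1 + (1 - α) * m2 with hn_def
  have h1 := h.1
  have h2 := h.2.1
  have hφ := h1.convex_comb h2 α (1 - α)
  set φ := fun y => α * φ1 y + (1 - α) * φ2 y with hφ_def
  obtain ⟨L, hL⟩ := hφ.2.2.1
  obtain ⟨L1, hL1⟩ := h1.2.2.1
  obtain ⟨L2, hL2⟩ := h2.2.2.1
  obtain ⟨A, B, hAB⟩ := hφ.exists_abs_parisiF_le hn.ne'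
  obtain ⟨A1, B1, hAB1⟩ := h1.exists_abs_parisiF_le hm1.ne'
  obtain ⟨A2, B2, hAB2⟩ := h2.exists_abs_parisiF_le hm2.ne'
  have hα0 := hα.1
  have hα1 : 0 ≤ 1 - α := sub_nonneg.2 hα.2
  set W := fun x s => α * parisiSlope φ1 m1 x s + (1 - α) * parisiSlope φ2 m2 x s with hW_def
  have hW : ∀ x s, |W x s| ≤ α * L1 + (1 - α) * L2 := by
    intro x s
    refine (abs_add_le _ _).trans ?_
    rw [abs_mul, abs_mul, abs_of_nonneg hα0, abs_of_nonneg hα1]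
    gcongr
    · exact h1.abs_parisiSlope_le hL1 _ _ _
    · exact h2.abs_parisiSlope_le hL2 _ _ _
  set S := L + (α * L1 + (1 - α) * L2) with hS
  have hVW : ∀ x s, |parisiSlope φ n x s + W x s| ≤ S := fun x s =>
    (abs_add_le _ _).trans (add_le_add (hφ.abs_parisiSlope_le hL _ _ _) (hW x s))
  have hS0 : 0 ≤ S := (abs_nonneg _).trans (hVW 0 0)
  have key := parabolic_maximum_principle
    (D := fun x t => parisiF φ n x t - (α * parisiF φ1 m1 x t + (1 - α) * parisiF φ2 m2 x t))
    (Dx := fun x t => parisiSlope φ n x √t - W x √t)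
    (A := A + (α * A1 + (1 - α) * A2)) (B := B + (α * B1 + (1 - α) * B2))
    (M := 1 / 2 * n * S) (by positivity)
    ((hφ.continuous_parisiF n).sub (((h1.continuous_parisiF m1).const_mul α).add
      ((h2.continuous_parisiF m2).const_mul (1 - α)))) ?_ ?_ ?_ ?_
  · intro x t ht
    exact sub_nonpos.1 (key x t ht)
  · intro x t ht
    have b0 := (le_abs_self _).trans (hAB x t ht)
    have b1 := mul_le_mul_of_nonneg_left ((neg_le_abs _).trans (hAB1 x t ht)) hα0
    have b2 := mul_le_mul_of_nonneg_left ((neg_le_abs _).trans (hAB2 x t ht)) hα1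
    linarith
  · intro x
    simp only [parisiF_zero hn.ne', parisiF_zero hm1.ne', parisiF_zero hm2.ne', hφ_def, sub_self,
      le_refl]
  · intro t x
    exact (hφ.hasDerivAt_parisiF hn.ne' x t).sub
      (((h1.hasDerivAt_parisiF hm1.ne' x t).const_mul α).add
        ((h2.hasDerivAt_parisiF hm2.ne' x t).const_mul (1 - α)))
  · intro x t ht
    obtain ⟨V, hV, hVt⟩ := hφ.exists_hasDerivAt_parisiF_time hn.ne' x ht
    obtain ⟨V1, hV1, hVt1⟩ := h1.exists_hasDerivAt_parisiF_time hm1.ne' x ht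
    obtain ⟨V2, hV2, hVt2⟩ := h2.exists_hasDerivAt_parisiF_time hm2.ne' x ht
    refine ⟨_, _, hV.sub ((hV1.const_mul α).add (hV2.const_mul (1 - α))),
      hVt.sub ((hVt1.const_mul α).add (hVt2.const_mul (1 - α))), ?_⟩
    have hsq := weighted_sq_le hα hm1 hm12
      (h.sq_parisiSlope_le hm1 hm12 (Real.sqrt_pos.2 ht) x)
    have hdrift : n * (parisiSlope φ n x √t ^ 2 - W x √t ^ 2) ≤
        n * (S * |parisiSlope φ n x √t - W x √t|) := by
      refine mul_le_mul_of_nonneg_left ?_ hn.le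
      rw [sq_sub_sq]
      refine (le_abs_self _).trans ?_
      rw [abs_mul]
      gcongr
      exact hVW x √t
    simp only [hW_def] at hdrift ⊢
    linarith
end

section
/- Let φ : ℝ → ℝ be twice differentiable with bounded first and second derivatives, even and convex, and let x ∈ ℝ. Then the function m ↦ (1/m)·log E[exp(m·φ(x + Z))] is convex on the interval (0,1]. -/
open MeasureTheory ProbabilityTheory Set

theorem hasDerivAt_integral_Iic {p : ℝ → ℝ} (hc : Continuous p) (hi : Integrable p) (y : ℝ) :
    HasDerivAt (fun t => ∫ u in Iic t, p u) (p y) y := by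
  have h : (fun t => ∫ u in Iic t, p u) = fun t => (∫ u in Iic (0 : ℝ), p u) + ∫ u in (0)..t, p u := by
    funext t
    rw [← intervalIntegral.integral_Iic_sub_Iic hi.integrableOn hi.integrableOn]
    ring
  rw [h]
  exact (hc.integral_hasStrictDerivAt 0 y).hasDerivAt.const_add _

theorem strictMono_integral_Iic {p : ℝ → ℝ} (hc : Continuous p) (hpos : ∀ u, 0 < p u)
    (hi : Integrable p) : StrictMono fun t => ∫ u in Iic t, p u :=
  strictMono_of_hasDerivAt_pos (hasDerivAt_integral_Iic hc hi) hpos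

theorem tendsto_integral_Iic_atBot {p : ℝ → ℝ} :
    Filter.Tendsto (fun t => ∫ u in Iic t, p u) Filter.atBot (nhds 0) :=
  tendsto_integral_Iic_zero Filter.tendsto_id

theorem tendsto_integral_Iic_atTop {p : ℝ → ℝ} (hi : Integrable p) :
    Filter.Tendsto (fun t => ∫ u in Iic t, p u) Filter.atTop (nhds (∫ u, p u)) :=
  (aecover_Iic Filter.tendsto_id).integral_tendsto_of_countably_generated hi

/-- The monotone rearrangement of a positive continuous density onto another one of the same
mass. -/
theorem exists_monotone_rearrangement {p q : ℝ → ℝ} (hpc : Continuous p) (hppos : ∀ u, 0 < p u)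
    (hpi : Integrable p) (hqc : Continuous q) (hqpos : ∀ u, 0 < q u) (hqi : Integrable q)
    (hpq : ∫ u, p u = ∫ u, q u) :
    ∃ S : ℝ → ℝ, (∀ y, HasDerivAt S (p y / q (S y)) y) ∧
      ∀ y, ∫ u in Iic (S y), q u = ∫ u in Iic y, p u := by
  have hPm := strictMono_integral_Iic hpc hppos hpi
  have hQm := strictMono_integral_Iic hqc hqpos hqi
  have hQd := hasDerivAt_integral_Iic hqc hqi
  have hPd := hasDerivAt_integral_Iic hpc hpi
  have hex : ∀ y, ∃ s, ∫ u in Iic s, q u = ∫ u in Iic y, p u := by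
    intro y
    have h0 : 0 < ∫ u in Iic y, p u :=
      (hPm.monotone.le_of_tendsto tendsto_integral_Iic_atBot (y - 1)).trans_lt
        (hPm (by linarith : y - 1 < y))
    have h1 : ∫ u in Iic y, p u < ∫ u, q u := hpq ▸
      (hPm (by linarith : y < y + 1)).trans_le
        (hPm.monotone.ge_of_tendsto (tendsto_integral_Iic_atTop hpi) (y + 1))
    obtain ⟨s, hs⟩ := (tendsto_integral_Iic_atBot (p := q)).eventually (gt_mem_nhds h0) |>.exists
    obtain ⟨t, ht⟩ := (tendsto_integral_Iic_atTop hqi).eventually (lt_mem_nhds h1) |>.exists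
    exact mem_range_of_exists_le_of_exists_ge
      (continuous_iff_continuousAt.2 fun z => (hQd z).continuousAt) ⟨s, hs.le⟩ ⟨t, ht.le⟩
  choose S hS using hex
  refine ⟨S, fun y => ?_, hS⟩
  have hstrict : HasStrictDerivAt (fun t => ∫ u in Iic t, q u) (q (S y)) (S y) :=
    hasStrictDerivAt_of_hasDerivAt_of_continuousAt (.of_forall hQd) hqc.continuousAt
  have hne : q (S y) ≠ 0 := (hqpos _).ne'
  have hg := (hstrict.to_localInverse hne).hasDerivAt
  have hr := hstrict.eventually_right_inverse hne
  simp only [hS y] at hg hr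
  have hcomp := hg.comp y (hPd y)
  rw [div_eq_inv_mul]
  refine hcomp.congr_of_eventuallyEq ?_
  filter_upwards [(hPd y).continuousAt.eventually hr] with z hz
  exact hQm.injective ((hS z).trans hz.symm)

/-- If a function vanishes at infinity and at `y₁`, and its derivative has the same sign as
a convex function, then it is nonpositive to the right of `y₁`. -/
theorem nonpos_right_of_deriv_sign_convex {K K' h : ℝ → ℝ} (hK : ∀ y, HasDerivAt K (K' y) y)
    (hh : ConvexOn ℝ univ h) (hsign : ∀ y, 0 < K' y ↔ 0 < h y) (hsign' : ∀ y, K' y < 0 ↔ h y < 0)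
    (hbot : Filter.Tendsto K Filter.atBot (nhds 0)) (htop : Filter.Tendsto K Filter.atTop (nhds 0))
    {y₁ y₂ : ℝ} (h12 : y₁ < y₂) (h1 : K y₁ = 0) : K y₂ ≤ 0 := by
  by_contra! h2
  have hcont : Continuous K := continuous_iff_continuousAt.2 fun y => (hK y).continuousAt
  obtain ⟨ξ, hξ, hξ'⟩ := exists_hasDerivAt_eq_slope K K' h12 hcont.continuousOn fun y _ => hK y
  have hξpos : 0 < h ξ := by
    rw [← hsign, hξ', h1, sub_zero]
    exact div_pos h2 (by linarith)
  obtain ⟨y₃, hy₃, h23⟩ :=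
    ((htop.eventually (gt_mem_nhds h2)).and (Filter.eventually_gt_atTop y₂)).exists
  obtain ⟨η, hη, hη'⟩ := exists_hasDerivAt_eq_slope K K' h23 hcont.continuousOn fun y _ => hK y
  have hηneg : h η < 0 := by
    rw [← hsign', hη']
    exact div_neg_of_neg_of_pos (by linarith) (by linarith)
  obtain ⟨ζ, hζ, hζ'⟩ : ∃ ζ < y₁, h ζ ≤ 0 := by
    by_contra! hcon
    have hm : StrictMonoOn K (Iic y₁) := by
      refine strictMonoOn_of_deriv_pos (convex_Iic _) hcont.continuousOn fun y hy => ?_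
      rw [interior_Iic] at hy
      rw [(hK y).deriv, hsign]
      exact hcon y hy
    have ha : K (y₁ - 1) < 0 := h1 ▸ hm (by simp) (by simp) (by linarith)
    obtain ⟨z, hz, hz'⟩ :=
      ((hbot.eventually (lt_mem_nhds ha)).and (Filter.eventually_lt_atBot (y₁ - 1))).exists
    exact (hm (mem_Iic.2 (by linarith)) (by simp) hz').not_gt hz
  have hζξ : ζ < ξ := hζ.trans hξ.1
  have hξη : ξ < η := hξ.2.trans hη.1
  have := hh.le_max_of_mem_Icc (mem_univ ζ) (mem_univ η) (z := ξ) ⟨hζξ.le, hξη.le⟩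
  exact absurd (hξpos.trans_le this) (by simp [hζ', hηneg.le])

theorem gaussianPDFReal_zero_one (y : ℝ) :
    gaussianPDFReal 0 1 y = (√(2 * Real.pi))⁻¹ * Real.exp (-y ^ 2 / 2) := by
  simp [gaussianPDFReal]

theorem continuous_gaussianPDFReal_zero_one : Continuous (gaussianPDFReal 0 1) := by
  have : gaussianPDFReal 0 1 = fun y => (√(2 * Real.pi))⁻¹ * Real.exp (-y ^ 2 / 2) :=
    funext gaussianPDFReal_zero_one
  rw [this]
  fun_prop

theorem gaussianPDFReal_zero_one_pos (y : ℝ) : 0 < gaussianPDFReal 0 1 y :=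
  gaussianPDFReal_pos 0 1 y one_ne_zero

/-- The monotone rearrangement of a log-convex perturbation of the standard Gaussian density onto
the Gaussian density is a contraction. -/
theorem exists_contraction_gaussian {g : ℝ → ℝ} (hg : ConvexOn ℝ univ g) (hgc : Continuous g)
    (hi : Integrable fun y => Real.exp (g y) * gaussianPDFReal 0 1 y)
    (h1 : ∫ y, Real.exp (g y) * gaussianPDFReal 0 1 y = 1) :
    ∃ S σ : ℝ → ℝ, ∀ y, HasDerivAt S (σ y) y ∧ 0 < σ y ∧ σ y ≤ 1 ∧
      σ y * gaussianPDFReal 0 1 (S y) = Real.exp (g y) * gaussianPDFReal 0 1 y := by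
  set p : ℝ → ℝ := fun y => Real.exp (g y) * gaussianPDFReal 0 1 y with hp
  have hpc : Continuous p := (by fun_prop : Continuous fun y => Real.exp (g y)).mul
    continuous_gaussianPDFReal_zero_one
  have hppos : ∀ y, 0 < p y := fun y => mul_pos (Real.exp_pos _) (gaussianPDFReal_zero_one_pos y)
  have hqc := continuous_gaussianPDFReal_zero_one
  have hqi := integrable_gaussianPDFReal 0 1
  have hq1 := integral_gaussianPDFReal_eq_one 0 (one_ne_zero : (1 : NNReal) ≠ 0)
  obtain ⟨S, hS, hmass⟩ := exists_monotone_rearrangement hpc hppos hi hqc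
    gaussianPDFReal_zero_one_pos hqi (h1.trans hq1.symm)
  have hlip : ∀ y₁ y₂, y₁ < y₂ → S y₂ - S y₁ ≤ y₂ - y₁ := by
    intro y₁ y₂ h12
    obtain ⟨c, hc⟩ : ∃ c, c = y₁ - S y₁ := ⟨_, rfl⟩
    have hshift : ∀ y, gaussianPDFReal 0 1 (y - c)
        = Real.exp (c * y - c ^ 2 / 2) * gaussianPDFReal 0 1 y := by
      intro y
      rw [gaussianPDFReal_zero_one, gaussianPDFReal_zero_one, mul_left_comm, ← Real.exp_add]
      congr 2
      ring
    have hK : ∀ y, HasDerivAt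
        (fun y => (∫ u in Iic y, p u) - ∫ u in Iic (y - c), gaussianPDFReal 0 1 u)
        (p y - gaussianPDFReal 0 1 (y - c)) y := fun y =>
      (hasDerivAt_integral_Iic hpc hi y).sub
        ((hasDerivAt_integral_Iic hqc hqi (y - c)).comp_sub_const y c)
    have hh : ConvexOn ℝ univ fun y => g y - (c * y - c ^ 2 / 2) := by
      refine hg.sub ⟨convex_univ, fun u _ v _ a b _ _ hab => ?_⟩
      simp only [smul_eq_mul]
      have : b = 1 - a := by linarith
      subst this
      nlinarith
    have hle := nonpos_right_of_deriv_sign_convex hK hh ?_ ?_ ?_ ?_ h12 ?_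
    · rw [sub_nonpos, ← hmass y₂,
        (strictMono_integral_Iic hqc gaussianPDFReal_zero_one_pos hqi).le_iff_le] at hle
      linarith
    · intro y
      rw [hshift, hp, ← sub_mul, mul_pos_iff_of_pos_right (gaussianPDFReal_zero_one_pos y),
        sub_pos, sub_pos, Real.exp_lt_exp]
    · intro y
      rw [hshift, hp, sub_neg, sub_neg, mul_lt_mul_iff_left₀ (gaussianPDFReal_zero_one_pos y),
        Real.exp_lt_exp]
    · simpa [sub_eq_add_neg] using tendsto_integral_Iic_atBot.sub
        (tendsto_integral_Iic_atBot.comp (Filter.tendsto_atBot_add_const_right _ (-c)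
          Filter.tendsto_id))
    · simpa [h1, hq1, sub_eq_add_neg] using (tendsto_integral_Iic_atTop hi).sub
        ((tendsto_integral_Iic_atTop hqi).comp (Filter.tendsto_atTop_add_const_right _ (-c)
          Filter.tendsto_id))
    · rw [hc, sub_sub_cancel, hmass, sub_self]
  refine ⟨S, fun y => p y / gaussianPDFReal 0 1 (S y), fun y => ⟨hS y,
    div_pos (hppos y) (gaussianPDFReal_zero_one_pos _), ?_,
    div_mul_cancel₀ _ (gaussianPDFReal_zero_one_pos _).ne'⟩⟩
  have hanti : Antitone fun y => S y - y := by
    intro y₁ y₂ h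
    rcases h.eq_or_lt with rfl | h
    · exact le_rfl
    · have := hlip y₁ y₂ h
      simp only
      linarith
  have hd := ((hS y).sub (hasDerivAt_id y)).deriv
  have hnp : deriv (S - id) y ≤ 0 := hanti.deriv_nonpos
  linarith

/-- The tangent line at `l = 1` of the convex function `l ↦ log (1 + l * r) / l`, multiplied
by `l`. -/
theorem tangent_le_log_one_add_mul {l r : ℝ} (hl : 0 < l) (hr : 0 ≤ r) :
    l * Real.log (1 + r) + l * (l - 1) * (r / (1 + r) - Real.log (1 + r))
      ≤ Real.log (1 + l * r) := by
  let H : ℝ → ℝ := fun r => Real.log (1 + l * r)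
    - (l * Real.log (1 + r) + l * (l - 1) * (r / (1 + r) - Real.log (1 + r)))
  have hd : ∀ t, 0 ≤ t → HasDerivAt H (l * ((l - 1) * t) ^ 2 / ((1 + l * t) * (1 + t) ^ 2)) t := by
    intro t ht
    have h1 : 1 + t ≠ 0 := by positivity
    have h2 : 1 + l * t ≠ 0 := by positivity
    have d1 : HasDerivAt (fun r : ℝ => 1 + r) 1 t := (hasDerivAt_id t).const_add 1
    have d2 : HasDerivAt (fun r : ℝ => 1 + l * r) l t := by
      simpa using ((hasDerivAt_id t).const_mul l).const_add 1
    have d := (d2.log h2).sub (((d1.log h1).const_mul l).add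
      ((((hasDerivAt_id t).div d1 h1).sub (d1.log h1)).const_mul (l * (l - 1))))
    have dH : HasDerivAt H _ t := d
    refine dH.congr_deriv ?_
    simp only [id]
    field_simp
    ring
  have hm : MonotoneOn H (Ici 0) := by
    refine monotoneOn_of_deriv_nonneg (convex_Ici 0)
      (fun t ht => (hd t ht).continuousAt.continuousWithinAt)
      (fun t ht => (hd t (interior_subset ht)).differentiableAt.differentiableWithinAt)
      fun t ht => ?_
    have ht' : 0 ≤ t := interior_subset ht
    rw [(hd t ht').deriv]
    positivity
  have h := hm (mem_Ici.2 le_rfl) (mem_Ici.2 hr) hr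
  simp only [H, mul_zero, add_zero, Real.log_one, zero_div, sub_zero] at h
  linarith

/-- Pointwise inequality for the linear interpolation between the Gaussian source and a tilted
target: `s`, `σ` are the value and the slope of the transport map at `y`. -/
theorem pointwise_interpolation_le {a b m m₁ m₂ s σ y P P₁ P₂ L : ℝ} (hm : 0 < m) (hm₁ : 0 < m₁)
    (hm₂ : 0 < m₂) (ha : 0 ≤ a) (hb : 0 ≤ b) (hab : a + b = 1) (habm : a * m₁ + b * m₂ = m)
    (hσ : 0 < σ) (hσ1 : σ ≤ 1) (hP : P ≤ a * P₁ + b * P₂)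
    (hL : Real.log σ - s ^ 2 / 2 = m * P - y ^ 2 / 2 - L) :
    L / m ≤
      a / m₁ * (m₁ * P₁ - (s + m₁ / m * (y - s)) ^ 2 / 2 + Real.log (σ + m₁ / m * (1 - σ))
        + s ^ 2 / 2 - Real.log σ) +
      b / m₂ * (m₂ * P₂ - (s + m₂ / m * (y - s)) ^ 2 / 2 + Real.log (σ + m₂ / m * (1 - σ))
        + s ^ 2 / 2 - Real.log σ) := by
  have key : ∀ l, 0 < l → -l * Real.log σ + l * (l - 1) * (1 - σ + Real.log σ)
      ≤ Real.log (σ + l * (1 - σ)) - Real.log σ := by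
    intro l hl
    have h := tangent_le_log_one_add_mul (r := 1 / σ - 1) hl
      (by rw [sub_nonneg, le_div_iff₀ hσ]; linarith)
    have e1 : 1 + (1 / σ - 1) = σ⁻¹ := by rw [one_div]; ring
    have e2 : 1 + l * (1 / σ - 1) = (σ + l * (1 - σ)) / σ := by field_simp
    have e3 : (1 / σ - 1) / σ⁻¹ = 1 - σ := by field_simp
    rw [e2, e1, e3, Real.log_inv, Real.log_div (by nlinarith) hσ.ne'] at h
    linarith
  have weighted : ∀ c Q n, 0 ≤ c → 0 < n → c * Q + c / m * (-s * (y - s) - n / m * (y - s) ^ 2 / 2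
      + (-Real.log σ + (n / m - 1) * (1 - σ + Real.log σ))) ≤
      c / n * (n * Q - (s + n / m * (y - s)) ^ 2 / 2 + Real.log (σ + n / m * (1 - σ))
        + s ^ 2 / 2 - Real.log σ) := by
    intro c Q n hc hn
    have h := mul_le_mul_of_nonneg_left (key (n / m) (by positivity))
      (by positivity : 0 ≤ c / n)
    have e : c / n * (-(n / m) * Real.log σ + n / m * (n / m - 1) * (1 - σ + Real.log σ))
      = c / m * (-Real.log σ + (n / m - 1) * (1 - σ + Real.log σ)) := by
      field_simp
    rw [e] at h
    have e' : c / n * (n * Q - (s + n / m * (y - s)) ^ 2 / 2 + s ^ 2 / 2)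
      = c * Q + c / m * (-s * (y - s) - n / m * (y - s) ^ 2 / 2) := by
      field_simp
      ring
    linarith
  refine le_trans (le_of_eq_of_le ?_ (add_le_add_left hP
    (1 / m * (-s * (y - s) - (y - s) ^ 2 / 2 - Real.log σ)))) (le_of_eq_of_le ?_
    (add_le_add (weighted a P₁ m₁ ha hm₁) (weighted b P₂ m₂ hb hm₂)))
  · field_simp
    linarith
  · have hmm : a * (m₁ / m) + b * (m₂ / m) = 1 := by
      rw [← mul_div_assoc, ← mul_div_assoc, ← add_div, habm, div_self hm.ne']
    linear_combination (1 / m * (s * (y - s) + Real.log σ + (1 - σ + Real.log σ))) * hab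
      + (1 / m * ((y - s) ^ 2 / 2 - (1 - σ + Real.log σ))) * hmm

theorem lintegral_comp_mul_deriv_le {w Y Y' : ℝ → ℝ} (hY : ∀ y, HasDerivAt Y (Y' y) y)
    (hY' : ∀ y, 0 < Y' y) :
    ∫⁻ y, ENNReal.ofReal (Y' y * w (Y y)) ≤ ∫⁻ y, ENNReal.ofReal (w y) := by
  have hinj : Function.Injective Y := (strictMono_of_hasDerivAt_pos hY hY').injective
  have h := lintegral_image_eq_lintegral_abs_deriv_mul MeasurableSet.univ
    (fun y _ => (hY y).hasDerivWithinAt) hinj.injOn fun y => ENNReal.ofReal (w y)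
  rw [Measure.restrict_univ] at h
  refine le_trans (le_of_eq_of_le ?_ h.ge) (setLIntegral_le_lintegral _ _)
  exact lintegral_congr fun y => by
    rw [abs_of_pos (hY' y), ENNReal.ofReal_mul (hY' y).le]

theorem integrable_exp_mul_gaussianPDFReal_of_le {ψ : ℝ → ℝ} (hψ : Continuous ψ) {A B : ℝ}
    (hle : ∀ z, ψ z ≤ A + B * |z|) :
    Integrable fun z => Real.exp (ψ z) * gaussianPDFReal 0 1 z := by
  have hi : Integrable (fun z : ℝ => Real.exp (B * |z|)) (gaussianReal 0 1) :=
    integrable_exp_mul_abs (integrable_exp_mul_gaussianReal B) (integrable_exp_mul_gaussianReal (-B))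
  have hexp : Integrable (fun z => Real.exp (ψ z)) (gaussianReal 0 1) := by
    refine (hi.const_mul (Real.exp A)).mono' (by fun_prop) (.of_forall fun z => ?_)
    rw [Real.norm_eq_abs, Real.abs_exp, ← Real.exp_add]
    exact Real.exp_le_exp.2 (hle z)
  rw [gaussianReal_of_var_ne_zero 0 one_ne_zero,
    integrable_withDensity_iff_integrable_smul' (measurable_gaussianPDF 0 1)
      (.of_forall fun _ => gaussianPDF_lt_top)] at hexp
  simpa [mul_comm] using hexp

/-- For convex `φ` the normalized log-Laplace transform `m ↦ (1 / m) log E exp (m φ (x + Z))`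
satisfies the convexity inequality. -/
theorem log_integral_exp_convex_ineq {ψ : ℝ → ℝ} (hψ : ConvexOn ℝ univ ψ) (hc : Continuous ψ)
    (hi : ∀ t, 0 < t → Integrable fun z => Real.exp (t * ψ z) * gaussianPDFReal 0 1 z)
    {a b m m₁ m₂ : ℝ} (hm₁ : 0 < m₁) (hm₂ : 0 < m₂) (ha : 0 ≤ a) (hb : 0 ≤ b) (hab : a + b = 1)
    (habm : a * m₁ + b * m₂ = m) :
    Real.log (∫ z, Real.exp (m * ψ z) * gaussianPDFReal 0 1 z) / m ≤
      a / m₁ * Real.log (∫ z, Real.exp (m₁ * ψ z) * gaussianPDFReal 0 1 z) +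
      b / m₂ * Real.log (∫ z, Real.exp (m₂ * ψ z) * gaussianPDFReal 0 1 z) := by
  have hm : 0 < m := by
    rw [← habm]
    rcases ha.eq_or_lt with rfl | ha
    · have : b = 1 := by linarith
      simp [this, hm₂]
    · positivity
  set I : ℝ → ℝ := fun t => ∫ z, Real.exp (t * ψ z) * gaussianPDFReal 0 1 z with hI
  have hwpos : ∀ t z, 0 < Real.exp (t * ψ z) * gaussianPDFReal 0 1 z := fun t z =>
    mul_pos (Real.exp_pos _) (gaussianPDFReal_zero_one_pos z)
  have hIpos : ∀ t, 0 < t → 0 < I t := fun t ht => by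
    rw [hI]
    refine (integral_pos_iff_support_of_nonneg (fun z => (hwpos t z).le) (hi t ht)).2 ?_
    rw [Function.support_eq_univ fun z => (hwpos t z).ne']
    simp
  have hIl : ∀ t, 0 < t → ∫⁻ z, ENNReal.ofReal (Real.exp (t * ψ z) * gaussianPDFReal 0 1 z)
      = ENNReal.ofReal (I t) := fun t ht =>
    (ofReal_integral_eq_lintegral_ofReal (hi t ht) (.of_forall fun z => (hwpos t z).le)).symm
  set L := Real.log (I m) with hL
  have hnorm : ∀ y, Real.exp (m * ψ y - L) * gaussianPDFReal 0 1 y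
      = (I m)⁻¹ * (Real.exp (m * ψ y) * gaussianPDFReal 0 1 y) := fun y => by
    rw [Real.exp_sub, hL, Real.exp_log (hIpos m hm)]
    ring
  have hni : Integrable fun y => Real.exp (m * ψ y - L) * gaussianPDFReal 0 1 y := by
    simp only [hnorm]
    exact (hi m hm).const_mul _
  have hn1 : ∫ y, Real.exp (m * ψ y - L) * gaussianPDFReal 0 1 y = 1 := by
    simp only [hnorm]
    rw [integral_const_mul]
    exact inv_mul_cancel₀ (hIpos m hm).ne'
  have hgconv : ConvexOn ℝ univ fun y => m * ψ y - L := by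
    exact (hψ.smul hm.le).add_const (-L)
  obtain ⟨S, σ, hS⟩ := exists_contraction_gaussian hgconv (by fun_prop) hni hn1
  have hSc : Continuous S := continuous_iff_continuousAt.2 fun y => (hS y).1.continuousAt
  have hlog : ∀ z, Real.log (gaussianPDFReal 0 1 z)
      = Real.log (√(2 * Real.pi))⁻¹ - z ^ 2 / 2 := fun z => by
    rw [gaussianPDFReal_zero_one, Real.log_mul (by positivity) (Real.exp_pos _).ne', Real.log_exp]
    ring
  have hσm : Measurable σ := by
    have : σ = deriv S := funext fun y => (hS y).1.deriv.symm
    rw [this]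
    exact measurable_deriv S
  let Y : ℝ → ℝ → ℝ := fun n y => S y + n / m * (y - S y)
  let Y' : ℝ → ℝ → ℝ := fun n y => σ y + n / m * (1 - σ y)
  have hY : ∀ n y, HasDerivAt (Y n) (Y' n y) y := fun n y =>
    (hS y).1.add (((hasDerivAt_id y).sub (hS y).1).const_mul _)
  have hY' : ∀ n, 0 < n → ∀ y, 0 < Y' n y := fun n hn y =>
    add_pos_of_pos_of_nonneg (hS y).2.1
      (mul_nonneg (by positivity) (sub_nonneg.2 (hS y).2.2.1))
  let h : ℝ → ℝ → ℝ := fun n y => Y' n y * (Real.exp (n * ψ (Y n y)) * gaussianPDFReal 0 1 (Y n y))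
  have hpos : ∀ n, 0 < n → ∀ y, 0 < h n y := fun n hn y => mul_pos (hY' n hn y) (hwpos _ _)
  have hle : ∀ n, 0 < n → ∫⁻ y, ENNReal.ofReal (h n y) ≤ ENNReal.ofReal (I n) := fun n hn =>
    (lintegral_comp_mul_deriv_le (w := fun z => Real.exp (n * ψ z) * gaussianPDFReal 0 1 z)
      (hY n) (hY' n hn)).trans_eq (hIl n hn)
  have hmeas : ∀ n, Measurable (h n) := fun n => by
    have hg := continuous_gaussianPDFReal_zero_one.measurable
    have hSm := hSc.measurable
    have hψm := hc.measurable
    fun_prop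
  set θ := (a / m₁ + b / m₂)⁻¹ with hθ
  have hden : 0 < a / m₁ + b / m₂ := by
    rcases ha.eq_or_lt with rfl | ha
    · have : b = 1 := by linarith
      simp [this, hm₂]
    · positivity
  have hθpos : 0 < θ := inv_pos.2 hden
  have hθ1 : θ * (a / m₁) + θ * (b / m₂) = 1 := by
    rw [← mul_add, hθ, inv_mul_cancel₀ hden.ne']
  have hα : 0 ≤ θ * (a / m₁) := by positivity
  have hβ : 0 ≤ θ * (b / m₂) := by positivity
  have hpt : ∀ y, Real.exp (θ * (L / m)) * (Real.exp (m * ψ y - L) * gaussianPDFReal 0 1 y)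
      ≤ h m₁ y ^ (θ * (a / m₁)) * h m₂ y ^ (θ * (b / m₂)) := by
    intro y
    obtain ⟨-, hσ0, hσ1, hσe⟩ := hS y
    have hle1 := Real.rpow_pos_of_pos (hpos m₁ hm₁ y) (θ * (a / m₁))
    have hle2 := Real.rpow_pos_of_pos (hpos m₂ hm₂ y) (θ * (b / m₂))
    have hg := gaussianPDFReal_zero_one_pos
    have hloge := congrArg Real.log hσe
    rw [Real.log_mul hσ0.ne' (hg _).ne', Real.log_mul (Real.exp_pos _).ne' (hg _).ne',
      Real.log_exp, hlog, hlog] at hloge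
    have hlogh : ∀ n, 0 < n → Real.log (h n y) = Real.log (Y' n y) + (n * ψ (Y n y)
        + (Real.log (√(2 * Real.pi))⁻¹ - Y n y ^ 2 / 2)) := fun n hn => by
      rw [Real.log_mul (hY' n hn y).ne' (hwpos _ _).ne',
        Real.log_mul (Real.exp_pos _).ne' (hg _).ne', Real.log_exp, hlog]
    have hmm : a * (m₁ / m) + b * (m₂ / m) = 1 := by
      rw [← mul_div_assoc, ← mul_div_assoc, ← add_div, habm, div_self hm.ne']
    have hP : ψ y ≤ a * ψ (Y m₁ y) + b * ψ (Y m₂ y) := by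
      have hcx := hψ.2 (mem_univ (Y m₁ y)) (mem_univ (Y m₂ y)) ha hb hab
      have e : a • Y m₁ y + b • Y m₂ y = y := by
        simp only [Y, smul_eq_mul]
        linear_combination S y * hab + (y - S y) * hmm
      rwa [e] at hcx
    have hcore := pointwise_interpolation_le (s := S y) (σ := σ y) (y := y) (L := L) hm hm₁ hm₂
      ha hb hab habm hσ0 hσ1 hP (by linarith)
    have hcore' := mul_le_mul_of_nonneg_left hcore hθpos.le
    rw [← hσe, ← Real.log_le_log_iff (mul_pos (Real.exp_pos _) (mul_pos hσ0 (hg _)))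
      (mul_pos hle1 hle2), Real.log_mul (Real.exp_pos _).ne' (mul_pos hσ0 (hg _)).ne',
      Real.log_mul hle1.ne' hle2.ne', Real.log_mul hσ0.ne' (hg _).ne', Real.log_exp,
      Real.log_rpow (hpos m₁ hm₁ y), Real.log_rpow (hpos m₂ hm₂ y), hlogh m₁ hm₁, hlogh m₂ hm₂,
      hlog]
    simp only [Y, Y'] at *
    linear_combination hcore' - (Real.log (√(2 * Real.pi))⁻¹ - S y ^ 2 / 2 + Real.log (σ y)) * hθ1
  have hmain : ENNReal.ofReal (Real.exp (θ * (L / m))) ≤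
      ENNReal.ofReal (I m₁ ^ (θ * (a / m₁)) * I m₂ ^ (θ * (b / m₂))) := by
    calc ENNReal.ofReal (Real.exp (θ * (L / m)))
        = ∫⁻ y, ENNReal.ofReal (Real.exp (θ * (L / m))
            * (Real.exp (m * ψ y - L) * gaussianPDFReal 0 1 y)) := by
          rw [← ofReal_integral_eq_lintegral_ofReal (hni.const_mul _)
            (.of_forall fun y => mul_nonneg (Real.exp_pos _).le
              (mul_nonneg (Real.exp_pos _).le (gaussianPDFReal_zero_one_pos y).le)),
            integral_const_mul, hn1, mul_one]
      _ ≤ ∫⁻ y, ENNReal.ofReal (h m₁ y) ^ (θ * (a / m₁))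
            * ENNReal.ofReal (h m₂ y) ^ (θ * (b / m₂)) := by
          refine lintegral_mono fun y => ?_
          rw [ENNReal.ofReal_rpow_of_pos (hpos m₁ hm₁ y), ENNReal.ofReal_rpow_of_pos (hpos m₂ hm₂ y),
            ← ENNReal.ofReal_mul (Real.rpow_nonneg (hpos m₁ hm₁ y).le _)]
          exact ENNReal.ofReal_le_ofReal (hpt y)
      _ ≤ (∫⁻ y, ENNReal.ofReal (h m₁ y)) ^ (θ * (a / m₁))
            * (∫⁻ y, ENNReal.ofReal (h m₂ y)) ^ (θ * (b / m₂)) :=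
          ENNReal.lintegral_mul_norm_pow_le (hmeas m₁).ennreal_ofReal.aemeasurable
            (hmeas m₂).ennreal_ofReal.aemeasurable hα hβ hθ1
      _ ≤ ENNReal.ofReal (I m₁) ^ (θ * (a / m₁)) * ENNReal.ofReal (I m₂) ^ (θ * (b / m₂)) := by
          gcongr
          · exact hle m₁ hm₁
          · exact hle m₂ hm₂
      _ = _ := by
          rw [ENNReal.ofReal_rpow_of_pos (hIpos m₁ hm₁), ENNReal.ofReal_rpow_of_pos (hIpos m₂ hm₂),
            ← ENNReal.ofReal_mul (Real.rpow_nonneg (hIpos m₁ hm₁).le _)]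
  have p1 := Real.rpow_pos_of_pos (hIpos m₁ hm₁) (θ * (a / m₁))
  have p2 := Real.rpow_pos_of_pos (hIpos m₂ hm₂) (θ * (b / m₂))
  rw [ENNReal.ofReal_le_ofReal_iff (mul_pos p1 p2).le, ← Real.le_log_iff_exp_le (mul_pos p1 p2),
    Real.log_mul p1.ne' p2.ne', Real.log_rpow (hIpos m₁ hm₁), Real.log_rpow (hIpos m₂ hm₂),
    mul_assoc, mul_assoc, ← mul_add] at hmain
  exact le_of_mul_le_mul_left hmain hθpos

theorem convexity_in_m_even (φ : ℝ → ℝ) (hφ : TwiceDiffBounded φ)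
    (heven : ∀ u, φ (-u) = φ u) (hconv : ConvexOn ℝ Set.univ φ) (x : ℝ) :
    ConvexOn ℝ (Set.Ioc (0 : ℝ) 1)
      (fun m => (1 / m) * Real.log (∫ z, Real.exp (m * φ (x + z)) ∂(gaussianReal 0 1))) := by
  obtain ⟨hd, -, ⟨C, hC⟩, -⟩ := hφ
  have hcont : Continuous φ := hd.continuous
  have hgrow : ∀ z, φ (x + z) ≤ φ x + C * |z| := fun z => by
    have h := convex_univ.norm_image_sub_le_of_norm_deriv_le (fun u _ => hd u)
      (fun u _ => hC u) (mem_univ x) (mem_univ (x + z))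
    rw [add_sub_cancel_left, Real.norm_eq_abs, Real.norm_eq_abs] at h
    linarith [le_abs_self (φ (x + z) - φ x)]
  have hψ : ConvexOn ℝ univ fun z => φ (x + z) := by
    have h := hconv.translate_right x
    rwa [preimage_univ] at h
  have hi : ∀ t, 0 < t →
      Integrable fun z => Real.exp (t * φ (x + z)) * gaussianPDFReal 0 1 z := fun t ht =>
    integrable_exp_mul_gaussianPDFReal_of_le (A := t * φ x) (B := t * C) (by fun_prop) fun z => by
      nlinarith [mul_le_mul_of_nonneg_left (hgrow z) ht.le]
  refine ⟨convex_Ioc 0 1, fun m₁ hm₁ m₂ hm₂ a b ha hb hab => ?_⟩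
  have h := log_integral_exp_convex_ineq hψ (by fun_prop) hi hm₁.1 hm₂.1 ha hb hab rfl
  simp only [integral_gaussianReal_eq_integral_smul (one_ne_zero : (1 : NNReal) ≠ 0), smul_eq_mul,
    mul_comm (gaussianPDFReal 0 1 _)]
  rwa [one_div_mul_eq_div, ← mul_assoc, ← mul_assoc, mul_one_div, mul_one_div]
end
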